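/- arXiv:1908.00806 — 2 statements merged into one kernel-verified Lean document; each statement's English description precedes it below -/
import Mathlib

section
/- Let Γ_i be the q-shift operator on functions of N variables x_1,...,x_N, acting by Γ_i f(...,x_i,...) = f(...,q x_i,...). For a ∈ {1,...,N} and k ∈ ℤ define the difference operator M_{a,k} = Σ_{I ⊆ {1,...,N}, |I|=a} (Π_{i∈I} x_i)^k · Π_{i∈I, j∉I} x_i/(x_i−x_j) · Π_{i∈I} Γ_i. Then for all a ∈ {1,...,N−1} and k ∈ ℤ, q^a · M_{a,k+1} ∘ M_{a,k−1} = M_{a,k} ∘ M_{a,k} − M_{a+1,k} ∘ M_{a−1,k}, where M_{0,k} is the identity operator. -/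
noncomputable section

open MvPolynomial

/-- The base field `ℚ(q^{1/2})`; `sQ` is the square root of `q`. -/
abbrev Rq : Type := RatFunc ℚ

/-- `q^{1/2}`. -/
def sQ : Rq := RatFunc.X

lemma sq_ne_zero : sQ ≠ 0 := RatFunc.X_ne_zero

/-- The parameter `q`. -/
def qq : Rq := sQ ^ 2

/-- Polynomials in the variables `y_i = x_i^{1/2}`, `i = 1, …, N`. -/
abbrev Pol (N : ℕ) := MvPolynomial (Fin N) Rq

/-- The field of rational functions in `x_1^{1/2}, …, x_N^{1/2}` over `ℚ(q^{1/2})`. -/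
abbrev K (N : ℕ) := FractionRing (Pol N)

/-- The substitution `y_j ↦ q^{v_j/2} y_j` on polynomials. -/
def shiftHom (N : ℕ) (v : Fin N → ℤ) : Pol N →ₐ[Rq] Pol N :=
  aeval fun j => C (sQ ^ v j) * X j

/-- The substitution `y_j ↦ q^{v_j/2} y_j` as an algebra automorphism of polynomials. -/
def shiftEquiv (N : ℕ) (v : Fin N → ℤ) : Pol N ≃ₐ[Rq] Pol N :=
  AlgEquiv.ofAlgHom (shiftHom N v) (shiftHom N (-v))
    (by
      apply MvPolynomial.algHom_ext
      intro j
      simp [shiftHom]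
      rw [← mul_assoc, ← C_mul, inv_mul_cancel₀ (zpow_ne_zero _ sq_ne_zero), C_1, one_mul])
    (by
      apply MvPolynomial.algHom_ext
      intro j
      simp [shiftHom]
      rw [← mul_assoc, ← C_mul, mul_inv_cancel₀ (zpow_ne_zero _ sq_ne_zero), C_1, one_mul])

/-- The `q`-shift operator `∏_i Γ_i^{v_i/2}` : the field automorphism of `K N` induced by the
substitution `y_j = x_j^{1/2} ↦ q^{v_j / 2} y_j`, i.e. `x_j ↦ q^{v_j} x_j`.  In particular
`Γ N (2 • v)` is the honest shift `x_j ↦ q^{v_j} x_j` and half-units allow `Γ_j^{1/2}`. -/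
def Γ (N : ℕ) (v : Fin N → ℤ) : K N ≃+* K N :=
  IsFractionRing.ringEquivOfRingEquiv (shiftEquiv N v).toRingEquiv

/-- The square root `y_i = x_i^{1/2}` of the `i`-th variable, inside `K N`. -/
def y (N : ℕ) (i : Fin N) : K N := algebraMap (Pol N) (K N) (X i)

/-- The `i`-th variable `x_i` of `K N`. -/
def x (N : ℕ) (i : Fin N) : K N := y N i ^ 2

/-- The parameter `q` inside `K N`. -/
def qK (N : ℕ) : K N := algebraMap (Pol N) (K N) (C qq)

end
noncomputable section

/-- The variables of type `A_{N-1}` Macdonald theory: `x_i`, realized as the generators of `K N`. -/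
def xA (N : ℕ) (i : Fin N) : K N := y N i

/-- `∏_i Γ_i^{v_i}`, where `Γ_i` is the `q`-shift operator `x_i ↦ q x_i`. -/
def ΓA (N : ℕ) (v : Fin N → ℤ) : K N ≃+* K N := Γ N (2 • v)

/-- The type `A` difference operators
`M_{a,k} = Σ_{I ⊆ [1,N], |I|=a} (Π_{i∈I} x_i)^k Π_{i∈I,j∉I} x_i/(x_i−x_j) Π_{i∈I} Γ_i`. -/
def MA (N : ℕ) (a : ℕ) (k : ℤ) : K N → K N := fun f =>
  ∑ I ∈ Finset.powersetCard a (Finset.univ : Finset (Fin N)),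
    (∏ i ∈ I, xA N i) ^ k *
      ((∏ i ∈ I, ∏ j ∈ Iᶜ, xA N i / (xA N i - xA N j)) *
        ΓA N (fun i => if i ∈ I then 1 else 0) f)

section
open Finset

lemma qs_pf {L ι : Type*} [Field L] [DecidableEq ι] (Q : Finset ι) (x y : ι → L)
    (n : Polynomial L) (hn : n.degree < ((2 * #Q : ℕ) : WithBot ℕ))
    (hx : Set.InjOn x Q) (hy : Set.InjOn y Q) (hxy : ∀ i ∈ Q, ∀ j ∈ Q, x i ≠ y j) (t : L)
    (htx : ∀ j ∈ Q, t ≠ x j) (hty : ∀ j ∈ Q, t ≠ y j) :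
    n.eval t * ∏ j ∈ Q, ((t - x j) * (t - y j))⁻¹ =
      ∑ l ∈ Q, (n.eval (x l) * ((t - x l)⁻¹ * (x l - y l)⁻¹ *
            ∏ j ∈ Q.erase l, ((x l - x j) * (x l - y j))⁻¹) +
          n.eval (y l) * ((t - y l)⁻¹ * (y l - x l)⁻¹ *
            ∏ j ∈ Q.erase l, ((y l - x j) * (y l - y j))⁻¹)) := by
  classical
  set v : ι ⊕ ι → L := Sum.elim x y
  have hv : Set.InjOn v (Q.disjSum Q : Finset (ι ⊕ ι)) := by
    rintro (i | i) hi (j | j) hj h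
    · simp [v] at hi hj h; rw [hx hi hj h]
    · simp [v] at hi hj h; exact absurd h (hxy _ hi _ hj)
    · simp [v] at hi hj h; exact absurd h.symm (hxy _ hj _ hi)
    · simp [v] at hi hj h; rw [hy hi hj h]
  have h1 := Lagrange.eq_interpolate (f := n) hv (by rw [card_disjSum, ← two_mul]; exact hn)
  have h2 := Lagrange.eval_interpolate_not_at_node (s := Q.disjSum Q) (v := v) (x := t)
    (fun i => n.eval (v i)) (by
      rintro (i | i) hi
      · simp [v] at hi ⊢; exact htx _ hi
      · simp [v] at hi ⊢; exact hty _ hi)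
  rw [← h1, Lagrange.eval_nodal, prod_disjSum, sum_disjSum] at h2
  have hne : ∏ j ∈ Q, ((t - x j) * (t - y j)) ≠ 0 :=
    prod_ne_zero_iff.2 fun j hj => mul_ne_zero (sub_ne_zero.2 (htx j hj)) (sub_ne_zero.2 (hty j hj))
  have e1 : ∀ l, (Q.disjSum Q).erase (Sum.inl l) = (Q.erase l).disjSum Q := by
    intro l; ext (i | i) <;> simp
  have e2 : ∀ l, (Q.disjSum Q).erase (Sum.inr l) = Q.disjSum (Q.erase l) := by
    intro l; ext (i | i) <;> simp
  rw [h2, ← sum_add_distrib, ← prod_mul_distrib, prod_inv_distrib, mul_comm, ← mul_assoc]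
  simp only [v, Sum.elim_inl, Sum.elim_inr]
  rw [inv_mul_cancel₀ hne, one_mul]
  refine sum_congr rfl fun l hl => ?_
  simp only [Lagrange.nodalWeight, e1, e2, prod_disjSum, Sum.elim_inl, Sum.elim_inr]
  rw [← mul_prod_erase Q (fun j => (x l - y j)⁻¹) hl, ← mul_prod_erase Q (fun j => (y l - x j)⁻¹) hl]
  simp only [mul_inv, prod_mul_distrib]
  ring

section QSys
variable {L ι : Type*} [Field L] [DecidableEq ι]

def qsG (q : L) (x : ι → L) (i j : ι) : L := ((x i - x j) * (x j - q * x i))⁻¹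

def qsT (q : L) (x : ι → L) (P Q : Finset ι) : L := ∏ i ∈ P, ∏ j ∈ Q, qsG q x i j

def qsW (q : L) (x : ι → L) (p : ℕ) (P Q : Finset ι) : L :=
  if #P = p then (∏ i ∈ P, x i) * (∏ i ∈ Q, x i) - q ^ p * (∏ i ∈ P, x i) ^ 2
  else if #P = p + 1 then - (∏ i ∈ Q, x i) ^ 2 else 0

open Polynomial in
def qsU (q : L) (x : ι → L) (p : ℕ) (P Q : Finset ι) : L[X] :=
  if #P + 1 = p then C ((∏ i ∈ P, x i) * (∏ i ∈ Q, x i)) * X - C (q ^ p * (∏ i ∈ P, x i) ^ 2) * X ^ 2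
  else if #P = p then C (- (∏ i ∈ Q, x i) ^ 2) else 0

open Polynomial in
def qsV (q : L) (x : ι → L) (p : ℕ) (P Q : Finset ι) : L[X] :=
  if #P = p then C ((∏ i ∈ P, x i) * (∏ i ∈ Q, x i)) * X - C (q ^ p * (∏ i ∈ P, x i) ^ 2)
  else if #P = p + 1 then C (- (∏ i ∈ Q, x i) ^ 2) * X ^ 2 else 0

lemma qsU_eval (q : L) (x : ι → L) (p : ℕ) (P Q : Finset ι) (o : ι) (hP : o ∉ P) :
    (qsU q x p P Q).eval (x o) = qsW q x p (insert o P) Q := by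
  unfold qsU qsW
  rw [card_insert_of_notMem hP, prod_insert hP]
  simp only [add_left_inj]
  split_ifs <;> simp [Polynomial.eval_prod] <;> ring

lemma qsV_eval (q : L) (x : ι → L) (p : ℕ) (P Q : Finset ι) (o : ι) (hQ : o ∉ Q) :
    (qsV q x p P Q).eval (x o) = qsW q x p P (insert o Q) := by
  unfold qsV qsW
  rw [prod_insert hQ]
  split_ifs <;> simp [Polynomial.eval_prod] <;> ring

lemma qsUV_eval (q : L) (x : ι → L) (p : ℕ) (P Q : Finset ι) (l : ι) (hP : l ∉ P) (hQ : l ∉ Q) :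
    (qsU q x p P (insert l Q)).eval (x l) = (qsV q x p (insert l P) Q).eval (x l) := by
  rw [qsU_eval _ _ _ _ _ _ hP, qsV_eval _ _ _ _ _ _ hQ]

lemma qsU_eval2 (q : L) (hq : q ≠ 0) (x : ι → L) (p : ℕ) (P Q : Finset ι) (l : ι) (hQ : l ∉ Q) :
    (q⁻¹) ^ #P * (qsU q x (p + 1) P (insert l Q)).eval (x l / q)
      = x l ^ 2 * (q⁻¹) ^ (p + 1) * qsW q x p P Q := by
  unfold qsU qsW
  rw [prod_insert hQ]
  simp only [add_left_inj]
  split_ifs with h1 h2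
  · rw [h1]; simp [Polynomial.eval_prod]; field_simp; ring
  · rw [h2]; simp [Polynomial.eval_prod]; ring
  · simp

lemma qsV_eval2 (q : L) (hq : q ≠ 0) (x : ι → L) (p : ℕ) (P Q : Finset ι) (l : ι) (hP : l ∉ P) :
    (q⁻¹) ^ #P * (qsV q x (p + 1) (insert l P) Q).eval (q * x l)
      = x l ^ 2 * q ^ 2 * (q⁻¹) ^ (p + 1) * qsW q x p P Q := by
  unfold qsV qsW
  rw [prod_insert hP, card_insert_of_notMem hP]
  simp only [add_left_inj]
  split_ifs with h1 h2
  · rw [h1]; simp [Polynomial.eval_prod]; field_simp; ring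
  · rw [h2]; simp [Polynomial.eval_prod]; ring
  · simp

lemma qsU_degree (q : L) (x : ι → L) (p : ℕ) (hp : 1 ≤ p) (P Q : Finset ι)
    (h : #P + #Q = 2 * p + 1) :
    (qsU q x (p + 1) P Q).degree < ((2 * #Q : ℕ) : WithBot ℕ) := by
  unfold qsU
  split_ifs with h1 h2
  · refine lt_of_le_of_lt (b := ((2 : ℕ) : WithBot ℕ)) (by compute_degree!) ?_
    exact_mod_cast (by omega)
  · refine lt_of_le_of_lt (b := ((0 : ℕ) : WithBot ℕ)) (by compute_degree!) ?_
    exact_mod_cast (by omega)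
  · rw [Polynomial.degree_zero]; exact WithBot.bot_lt_coe _

lemma qsV_degree (q : L) (x : ι → L) (p : ℕ) (P Q : Finset ι)  :
    (qsV q x (p + 1) P Q).degree < ((2 * #P : ℕ) : WithBot ℕ) := by
  unfold qsV
  split_ifs with h1 h2
  · refine lt_of_le_of_lt (b := ((1 : ℕ) : WithBot ℕ)) (by compute_degree!) ?_
    exact_mod_cast (by omega)
  · refine lt_of_le_of_lt (b := ((2 : ℕ) : WithBot ℕ)) (by compute_degree!) ?_
    exact_mod_cast (by omega)
  · rw [Polynomial.degree_zero]; exact WithBot.bot_lt_coe _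

/-- genericity -/
def qsGen (q : L) (x : ι → L) : Prop :=
  q ≠ 0 ∧ Function.Injective x ∧ ∀ i j, x i ≠ q * x j

lemma qs_pfU (q : L) (x : ι → L) (hg : qsGen q x) (Q : Finset ι) (o : ι) (ho : o ∉ Q)
    (n : Polynomial L) (hn : n.degree < ((2 * #Q : ℕ) : WithBot ℕ)) :
    n.eval (x o) * ∏ j ∈ Q, qsG q x o j =
      ∑ l ∈ Q, (n.eval (x l) * ((x o - x l)⁻¹ * (x l - q * x l)⁻¹ *
            ∏ j ∈ Q.erase l, qsG q x l j) +
          n.eval (x l / q) * ((x l / q - x l)⁻¹ * (x l - q * x o)⁻¹ *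
            ∏ j ∈ Q.erase l, ((x l / q - x j) * (x j - x l))⁻¹)) := by
  obtain ⟨hq, hx, hxq⟩ := hg
  have h := qs_pf Q x (fun j => x j / q) n hn hx.injOn
    (fun i _ j _ h => hx (by simpa [hq] using h))
    (fun i _ j _ h => hxq j i (by rw [h]; field_simp)) (x o)
    (fun j hj h => ho (hx h ▸ hj)) (fun j _ h => hxq j o (by rw [h]; field_simp))
  have k2 : ∀ t b : L, (t - b / q)⁻¹ = (-q) * (b - q * t)⁻¹ := by
    intro t b
    have : t - b / q = (b - q * t) * (-q)⁻¹ := by field_simp; ring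
    rw [this, mul_inv, inv_inv, mul_comm]
  have k3 : ∀ l, q * (x l / q) = x l := fun l => by field_simp
  have hc : ∀ A : Finset ι, (∏ _j ∈ A, (-q)) * ∏ _j ∈ A, (-q)⁻¹ = 1 := by
    intro A
    rw [← prod_mul_distrib]; exact prod_eq_one fun _ _ => mul_inv_cancel₀ (neg_ne_zero.2 hq)
  have hL : n.eval (x o) * ∏ j ∈ Q, qsG q x o j =
      (∏ _j ∈ Q, (-q)⁻¹) * (n.eval (x o) * ∏ j ∈ Q, ((x o - x j) * (x o - x j / q))⁻¹) := by
    simp only [mul_inv, k2, qsG, prod_mul_distrib]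
    linear_combination (-(n.eval (x o) * ((∏ j ∈ Q, (x o - x j)⁻¹) * ∏ j ∈ Q, (x j - q * x o)⁻¹)))
      * hc Q
  rw [hL, h, mul_sum]
  refine sum_congr rfl fun l hl => ?_
  rw [← mul_prod_erase Q (fun j => (-q)⁻¹) hl]
  simp only [mul_inv, k2, k3, qsG, prod_mul_distrib]
  have h0 := mul_inv_cancel₀ (neg_ne_zero.2 hq)
  have h1 := hc (Q.erase l)
  set c := ∏ _j ∈ Q.erase l, (-q) with hcdef
  set c' := ∏ _j ∈ Q.erase l, (-q)⁻¹ with hcdef'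
  have h3 : (-q)⁻¹ * c' * ((-q) * c) = 1 := by
    rw [show (-q)⁻¹ * c' * ((-q) * c) = (-q * (-q)⁻¹) * (c * c') by ring, h0, h1, one_mul]
  linear_combination
    (n.eval (x l) * ((x o - x l)⁻¹ * (x l - q * x l)⁻¹ *
      ((∏ j ∈ Q.erase l, (x l - x j)⁻¹) * ∏ j ∈ Q.erase l, (x j - q * x l)⁻¹)) +
     n.eval (x l / q) * ((x l / q - x l)⁻¹ * (x l - q * x o)⁻¹ *
      ((∏ j ∈ Q.erase l, (x l / q - x j)⁻¹) * ∏ j ∈ Q.erase l, (x j - x l)⁻¹))) * h3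

lemma qs_pfV (q : L) (x : ι → L) (hg : qsGen q x) (P : Finset ι) (o : ι) (ho : o ∉ P)
    (n : Polynomial L) (hn : n.degree < ((2 * #P : ℕ) : WithBot ℕ)) :
    n.eval (x o) * ∏ i ∈ P, qsG q x i o =
      ∑ l ∈ P, (n.eval (x l) * ((x l - x o)⁻¹ * (x l - q * x l)⁻¹ *
            ∏ i ∈ P.erase l, qsG q x i l) +
          n.eval (q * x l) * ((x l - q * x l)⁻¹ * (x o - q * x l)⁻¹ *
            ∏ i ∈ P.erase l, ((x i - q * x l) * (q * x l - q * x i))⁻¹)) := by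
  obtain ⟨hq, hx, hxq⟩ := hg
  have h := qs_pf P x (fun j => q * x j) n hn hx.injOn
    (fun i _ j _ h => hx (by simpa [hq] using h))
    (fun i _ j _ => hxq i j) (x o)
    (fun j hj h => ho (hx h ▸ hj)) (fun j _ => hxq o j)
  have k : ∀ a b : L, (a - b)⁻¹ = (-1) * (b - a)⁻¹ := by
    intro a b
    rw [← neg_sub, inv_neg]; ring
  have hc : ∀ A : Finset ι, (∏ _j ∈ A, (-1 : L)) * ∏ _j ∈ A, (-1 : L) = 1 := by
    intro A
    rw [← prod_mul_distrib]; exact prod_eq_one fun _ _ => by ring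
  have hL : n.eval (x o) * ∏ i ∈ P, qsG q x i o =
      (∏ _j ∈ P, (-1 : L)) * (n.eval (x o) * ∏ j ∈ P, ((x o - x j) * (x o - q * x j))⁻¹) := by
    simp only [mul_inv, k (x o) (x _), qsG, prod_mul_distrib]
    linear_combination (-(n.eval (x o) * ((∏ j ∈ P, (x j - x o)⁻¹) * ∏ j ∈ P, (x o - q * x j)⁻¹)))
      * hc P
  rw [hL, h, mul_sum]
  refine sum_congr rfl fun l hl => ?_
  rw [← mul_prod_erase P (fun j => (-1 : L)) hl]
  simp only [mul_inv, qsG, prod_mul_distrib]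
  rw [show ∏ i ∈ P.erase l, (x i - x l)⁻¹ = (∏ i ∈ P.erase l, (-1 : L)) * ∏ i ∈ P.erase l, (x l - x i)⁻¹
    by rw [← prod_mul_distrib]; exact prod_congr rfl fun i _ => k _ _]
  rw [show ∏ i ∈ P.erase l, (x i - q * x l)⁻¹ = (∏ i ∈ P.erase l, (-1 : L)) * ∏ i ∈ P.erase l, (q * x l - x i)⁻¹
    by rw [← prod_mul_distrib]; exact prod_congr rfl fun i _ => k _ _]
  rw [k (x l) (x o), k (q * x l) (x l)]
  ring

lemma qsT_insert_left (q : L) (x : ι → L) (P Q : Finset ι) (o : ι) (h : o ∉ P) :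
    qsT q x (insert o P) Q = (∏ j ∈ Q, qsG q x o j) * qsT q x P Q := by
  rw [qsT, prod_insert h, qsT]

lemma qsT_insert_right (q : L) (x : ι → L) (P Q : Finset ι) (o : ι) (h : o ∉ Q) :
    qsT q x P (insert o Q) = (∏ i ∈ P, qsG q x i o) * qsT q x P Q := by
  simp only [qsT, prod_insert h, prod_mul_distrib]

lemma qs_swap1 (S : Finset ι) (F : Finset ι → Finset ι → ι → L) :
    ∑ P ∈ S.powerset, ∑ l ∈ S \ P, F P (S \ P) l =
      ∑ l ∈ S, ∑ P ∈ (S.erase l).powerset, F P (insert l (S.erase l \ P)) l := by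
  rw [sum_comm' (t' := S) (s' := fun l => (S.erase l).powerset)]
  · refine sum_congr rfl fun l hl => sum_congr rfl fun P hP => ?_
    congr 1
    ext i
    have : l ∉ P := fun h => by simpa using (mem_powerset.1 hP) h
    by_cases hi : i = l
    · subst hi; simp [hl, this]
    · simp [hi]
  · intro P l
    simp only [mem_powerset, mem_sdiff, subset_erase]
    tauto

lemma qs_swap2 (S : Finset ι) (F : Finset ι → Finset ι → ι → L) :
    ∑ P ∈ S.powerset, ∑ l ∈ P, F P (S \ P) l =
      ∑ l ∈ S, ∑ P ∈ (S.erase l).powerset, F (insert l P) (S.erase l \ P) l := by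
  rw [sum_sigma', sum_sigma']
  refine sum_bij' (fun a _ => ⟨a.2, a.1.erase a.2⟩) (fun a _ => ⟨insert a.1 a.2, a.1⟩) ?_ ?_ ?_ ?_ ?_
  · rintro ⟨P, l⟩ h
    simp only [mem_sigma, mem_powerset] at h ⊢
    exact ⟨h.1 h.2, erase_subset_erase _ h.1⟩
  · rintro ⟨l, P⟩ h
    simp only [mem_sigma, mem_powerset, subset_erase] at h ⊢
    exact ⟨insert_subset h.1 h.2.1, mem_insert_self _ _⟩
  · rintro ⟨P, l⟩ h
    simp only [mem_sigma, mem_powerset] at h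
    simp [insert_erase h.2]
  · rintro ⟨l, P⟩ h
    simp only [mem_sigma, mem_powerset, subset_erase] at h
    simp [erase_insert h.2.2]
  · rintro ⟨P, l⟩ h
    simp only [mem_sigma, mem_powerset] at h
    simp only [insert_erase h.2]
    congr 1
    ext i
    by_cases hi : i = l
    · subst hi; simp [h.2]
    · simp [hi]

lemma qs_step (q : L) (x : ι → L) (hg : qsGen q x) (p : ℕ) (hp : 1 ≤ p)
    (IH : ∀ S : Finset ι, #S = 2 * p →
      ∑ P ∈ S.powerset, qsW q x p P (S \ P) * qsT q x P (S \ P) = 0)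
    (S : Finset ι) (o : ι) (ho : o ∉ S) (hS : #S = 2 * p + 1) :
    ∑ P ∈ (insert o S).powerset, qsW q x (p + 1) P (insert o S \ P) * qsT q x P (insert o S \ P)
      = 0 := by
  have hq := hg.1
  rw [sum_powerset_insert ho]
  have hV : ∀ P ∈ S.powerset, qsW q x (p + 1) P (insert o S \ P) * qsT q x P (insert o S \ P) =
      ∑ l ∈ P, ((qsV q x (p + 1) P (S \ P)).eval (x l) * ((x l - x o)⁻¹ * (x l - q * x l)⁻¹ *
            ∏ i ∈ P.erase l, qsG q x i l) +
          (qsV q x (p + 1) P (S \ P)).eval (q * x l) * ((x l - q * x l)⁻¹ * (x o - q * x l)⁻¹ *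
            ∏ i ∈ P.erase l, ((x i - q * x l) * (q * x l - q * x i))⁻¹)) * qsT q x P (S \ P) := by
    intro P hP
    rw [mem_powerset] at hP
    have hoP : o ∉ P := fun h => ho (hP h)
    have hoQ : o ∉ S \ P := fun h => ho (mem_sdiff.1 h).1
    rw [insert_sdiff_of_notMem _ hoP, ← qsV_eval _ _ _ _ _ _ hoQ, qsT_insert_right _ _ _ _ _ hoQ,
      ← mul_assoc, qs_pfV q x hg P o hoP _ (qsV_degree _ _ _ _ _), sum_mul]
  have hU : ∀ P ∈ S.powerset, qsW q x (p + 1) (insert o P) (insert o S \ insert o P) *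
        qsT q x (insert o P) (insert o S \ insert o P) =
      ∑ l ∈ S \ P, ((qsU q x (p + 1) P (S \ P)).eval (x l) * ((x o - x l)⁻¹ * (x l - q * x l)⁻¹ *
            ∏ j ∈ (S \ P).erase l, qsG q x l j) +
          (qsU q x (p + 1) P (S \ P)).eval (x l / q) * ((x l / q - x l)⁻¹ * (x l - q * x o)⁻¹ *
            ∏ j ∈ (S \ P).erase l, ((x l / q - x j) * (x j - x l))⁻¹)) * qsT q x P (S \ P) := by
    intro P hP
    rw [mem_powerset] at hP
    have hoP : o ∉ P := fun h => ho (hP h)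
    have hoQ : o ∉ S \ P := fun h => ho (mem_sdiff.1 h).1
    have hc : #P + #(S \ P) = 2 * p + 1 := by
      rw [← hS, card_sdiff_of_subset hP]; have := card_le_card hP; omega
    have e : insert o S \ insert o P = S \ P := by
      ext i
      by_cases hi : i = o
      · subst hi; simp [ho]
      · simp [hi]
    rw [e, ← qsU_eval _ _ _ _ _ _ hoP, qsT_insert_left _ _ _ _ _ hoP,
      ← mul_assoc, qs_pfU q x hg (S \ P) o hoQ _ (qsU_degree _ _ _ hp _ _ hc), sum_mul]
  rw [sum_congr rfl hV, sum_congr rfl hU]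
  rw [qs_swap1 S (fun P Q l => ((qsU q x (p + 1) P Q).eval (x l) * ((x o - x l)⁻¹ *
      (x l - q * x l)⁻¹ * ∏ j ∈ Q.erase l, qsG q x l j) +
      (qsU q x (p + 1) P Q).eval (x l / q) * ((x l / q - x l)⁻¹ * (x l - q * x o)⁻¹ *
      ∏ j ∈ Q.erase l, ((x l / q - x j) * (x j - x l))⁻¹)) * qsT q x P Q),
    qs_swap2 S (fun P Q l => ((qsV q x (p + 1) P Q).eval (x l) * ((x l - x o)⁻¹ *
      (x l - q * x l)⁻¹ * ∏ i ∈ P.erase l, qsG q x i l) +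
      (qsV q x (p + 1) P Q).eval (q * x l) * ((x l - q * x l)⁻¹ * (x o - q * x l)⁻¹ *
      ∏ i ∈ P.erase l, ((x i - q * x l) * (q * x l - q * x i))⁻¹)) * qsT q x P Q),
    ← sum_add_distrib]
  refine sum_eq_zero fun l hl => ?_
  rw [← sum_add_distrib]
  have hI := IH (S.erase l) (by rw [card_erase_of_mem hl]; omega)
  set A : L := (x l / q - x l)⁻¹ * (x l - q * x o)⁻¹ *
      (∏ j ∈ S.erase l, ((x l / q - x j) * (x j - x l))⁻¹) * (x l ^ 2 * (q⁻¹) ^ (p + 1)) with hA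
  set B : L := (x l - q * x l)⁻¹ * (x o - q * x l)⁻¹ *
      (∏ j ∈ S.erase l, qsG q x l j) * (x l ^ 2 * q ^ 2 * (q⁻¹) ^ (p + 1)) with hB
  rw [show (0 : L) = (A + B) * 0 by ring, ← hI, mul_sum]
  refine sum_congr rfl fun P hP => ?_
  rw [mem_powerset] at hP
  have hlP : l ∉ P := fun h => by simpa using hP h
  have hlQ : l ∉ S.erase l \ P := fun h => by simp at h
  have hprod : ∀ f : ι → L, ∏ j ∈ S.erase l, f j = (∏ j ∈ P, f j) * ∏ j ∈ S.erase l \ P, f j :=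
    fun f => by rw [mul_comm, prod_sdiff hP]
  rw [hprod] at hA hB
  generalize S.erase l \ P = Q at *
  rw [erase_insert hlP, erase_insert hlQ, qsT_insert_left _ _ _ _ _ hlP,
    qsT_insert_right _ _ _ _ _ hlQ, qsUV_eval _ _ _ _ _ _ hlP hlQ]
  have hu := qsU_eval2 q hq x p P Q l hlQ
  have hv := qsV_eval2 q hq x p P Q l hlP
  have g1 : ∏ i ∈ P, qsG q x i l = (q⁻¹) ^ #P * ∏ i ∈ P, ((x l / q - x i) * (x i - x l))⁻¹ := by
    rw [← prod_const, ← prod_mul_distrib]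
    refine prod_congr rfl fun i _ => ?_
    rw [qsG, ← mul_inv]; congr 1; field_simp
  have g2 : ∏ i ∈ P, ((x i - q * x l) * (q * x l - q * x i))⁻¹ =
      (q⁻¹) ^ #P * ∏ i ∈ P, qsG q x l i := by
    rw [← prod_const, ← prod_mul_distrib]
    refine prod_congr rfl fun i _ => ?_
    rw [qsG, ← mul_inv]; congr 1; ring
  have g3 : (x o - x l)⁻¹ = - (x l - x o)⁻¹ := by rw [← inv_neg, neg_sub]
  rw [g2, g3, hA, hB]
  linear_combination
    (x l / q - x l)⁻¹ * (x l - q * x o)⁻¹ *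
      ((∏ j ∈ P, ((x l / q - x j) * (x j - x l))⁻¹) * ∏ j ∈ Q, ((x l / q - x j) * (x j - x l))⁻¹) *
      qsT q x P Q * hu +
    (x l - q * x l)⁻¹ * (x o - q * x l)⁻¹ *
      ((∏ j ∈ P, qsG q x l j) * ∏ j ∈ Q, qsG q x l j) * qsT q x P Q * hv +
    (Polynomial.eval (x l / q) (qsU q x (p + 1) P (insert l Q))) * ((x l / q - x l)⁻¹ * (x l - q * x o)⁻¹ *
            ∏ j ∈ Q, ((x l / q - x j) * (x j - x l))⁻¹) * qsT q x P Q * g1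

lemma qs_main (q : L) (x : ι → L) (hg : qsGen q x) (p : ℕ) : ∀ S : Finset ι, #S = 2 * p →
      ∑ P ∈ S.powerset, qsW q x p P (S \ P) * qsT q x P (S \ P) = 0 := by
  induction p with
  | zero =>
    intro S hS
    have : S = ∅ := by simpa using hS
    subst this
    simp [qsW, qsT]
  | succ p ih =>
    intro S hS
    obtain ⟨o, S', ho, rfl, hS'⟩ := card_eq_succ.1 (show #S = (2 * p + 1) + 1 by omega)
    rcases Nat.eq_zero_or_pos p with rfl | hp
    · obtain ⟨l, rfl⟩ := card_eq_one.1 hS'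
      have hol : o ≠ l := by simpa using ho
      obtain ⟨hq, hx, hxq⟩ := hg
      have e1 : insert o ({l} : Finset ι) \ {o} = {l} := by
        ext i; simp; constructor
        · tauto
        · rintro rfl; simp [hol.symm]
      have e2 : insert o ({l} : Finset ι) \ {l} = {o} := by
        ext i; simp; constructor
        · tauto
        · rintro rfl; simp [hol]
      have h3 : ({l} : Finset ι).powerset = {∅, {l}} := by ext; simp [subset_singleton_iff]
      rw [sum_powerset_insert ho, h3]
      have hne : (∅ : Finset ι) ≠ {l} := (singleton_ne_empty l).symm
      rw [sum_pair hne, sum_pair hne]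
      simp only [insert_empty_eq, e1, e2, sdiff_self]
      have a1 : x o - x l ≠ 0 := sub_ne_zero.2 fun h => hol (hx h)
      have a2 : x l - x o ≠ 0 := sub_ne_zero.2 fun h => hol (hx h).symm
      have a3 : x l - q * x o ≠ 0 := sub_ne_zero.2 (hxq _ _)
      have a4 : x o - q * x l ≠ 0 := sub_ne_zero.2 (hxq _ _)
      simp [qsW, qsT, qsG, hol]
      generalize x o = u at *
      generalize x l = v at *
      have a5 : v - u * q ≠ 0 := by rwa [mul_comm]
      have a6 : u - v * q ≠ 0 := by rwa [mul_comm]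
      rw [← neg_sub u v]
      field_simp
      ring
    · exact qs_step q x hg p hp ih S' o ho hS'


lemma qs_regroup [Fintype ι] (F : Finset ι → Finset ι → L) :
    ∑ I, ∑ J, F I J =
      ∑ D : Finset ι, ∑ S ∈ Dᶜ.powerset, ∑ P ∈ S.powerset, F (D ∪ P) (D ∪ (S \ P)) := by
  have h : ∀ D : Finset ι, ∑ S ∈ Dᶜ.powerset, ∑ P ∈ S.powerset, F (D ∪ P) (D ∪ (S \ P)) =
    ∑ z ∈ Dᶜ.powerset.sigma (fun S => S.powerset), F (D ∪ z.2) (D ∪ (z.1 \ z.2)) := by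
    intro D; rw [sum_sigma]
  simp only [h]
  rw [← sum_product', sum_sigma']
  refine sum_bij' (fun a _ => ⟨a.1 ∩ a.2, ⟨(a.1 \ a.2) ∪ (a.2 \ a.1), a.1 \ a.2⟩⟩)
    (fun b _ => (b.1 ∪ b.2.2, b.1 ∪ (b.2.1 \ b.2.2))) ?_ ?_ ?_ ?_ ?_
  · rintro ⟨I, J⟩ _
    simp only [mem_sigma, mem_univ, mem_powerset, true_and]
    refine ⟨fun i hi => ?_, subset_union_left⟩
    simp at hi ⊢; tauto
  · intros; simp
  · rintro ⟨I, J⟩ _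
    simp only [Prod.mk.injEq]
    constructor
    · ext i; simp; tauto
    · ext i; simp; tauto
  · rintro ⟨D, S, P⟩ h
    simp only [mem_sigma, mem_univ, mem_powerset, true_and] at h
    have h1 : ∀ i, i ∈ S → i ∉ D := fun i hi => by simpa using h.1 hi
    have h2 : ∀ i, i ∈ P → i ∈ S := fun i hi => h.2 hi
    have e1 : (D ∪ P) ∩ (D ∪ (S \ P)) = D := by
      ext i; simp; tauto
    have e3 : (D ∪ P) \ (D ∪ (S \ P)) = P := by
      ext i; have := h1 i; have := h2 i; simp; tauto
    have e4 : (D ∪ (S \ P)) \ (D ∪ P) = S \ P := by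
      ext i; have := h1 i; have := h2 i; simp; tauto
    simp only [e1, e3, e4]
    rw [union_sdiff_of_subset h.2]
  · rintro ⟨I, J⟩ _
    simp only
    congr 1
    · ext i; simp; tauto
    · ext i; simp; tauto

def qsA [Fintype ι] (x : ι → L) (I : Finset ι) : L := ∏ i ∈ I, ∏ j ∈ Iᶜ, x i / (x i - x j)

def qsCom [Fintype ι] (q : L) (x : ι → L) (D S : Finset ι) : L :=
  (∏ i ∈ D, ∏ j ∈ S, x i / (x i - x j)) * (∏ i ∈ D, ∏ j ∈ (D ∪ S)ᶜ, x i / (x i - x j)) *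
  (∏ i ∈ D, ∏ j ∈ (D ∪ S)ᶜ, q * x i / (q * x i - x j)) *
  (∏ i ∈ S, ∏ j ∈ (D ∪ S)ᶜ, x i / (x i - x j))

lemma qs_bil_left (f : ι → ι → L) (P Q R : Finset ι) (h : Disjoint P Q) :
    ∏ i ∈ P ∪ Q, ∏ j ∈ R, f i j = (∏ i ∈ P, ∏ j ∈ R, f i j) * ∏ i ∈ Q, ∏ j ∈ R, f i j :=
  prod_union h

lemma qs_bil_right (f : ι → ι → L) (P Q R : Finset ι) (h : Disjoint P Q) :
    ∏ i ∈ R, ∏ j ∈ P ∪ Q, f i j = (∏ i ∈ R, ∏ j ∈ P, f i j) * ∏ i ∈ R, ∏ j ∈ Q, f i j := by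
  simp only [prod_union h, prod_mul_distrib]

lemma qs_coeff [Fintype ι] (q : L) (hq : q ≠ 0) (x : ι → L) (γ : Finset ι → L ≃+* L)
    (hγ : ∀ I i, γ I (x i) = if i ∈ I then q * x i else x i)
    (D P Q : Finset ι) (hDP : Disjoint D P) (hDQ : Disjoint D Q) (hPQ : Disjoint P Q) :
    qsA x (D ∪ P) * γ (D ∪ P) (qsA x (D ∪ Q)) =
      qsCom q x D (P ∪ Q) * ((∏ i ∈ P, x i) ^ #Q * (∏ i ∈ Q, x i) ^ #P * qsT q x P Q) := by
  set R := (D ∪ (P ∪ Q))ᶜ with hR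
  have dPQ : ∀ i, i ∈ P → i ∉ Q := fun i hi => disjoint_left.1 hPQ hi
  have dDP : ∀ i, i ∈ D → i ∉ P := fun i hi => disjoint_left.1 hDP hi
  have dDQ : ∀ i, i ∈ D → i ∉ Q := fun i hi => disjoint_left.1 hDQ hi
  have rR : ∀ i, i ∈ R → i ∉ D ∧ i ∉ P ∧ i ∉ Q := fun i hi => by
    simp [hR] at hi; tauto
  have c1 : (D ∪ P)ᶜ = Q ∪ R := by
    ext i; have := dPQ i; have := dDP i; have := dDQ i; simp [hR]; tauto
  have c2 : (D ∪ Q)ᶜ = P ∪ R := by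
    ext i; have := dPQ i; have := dDP i; have := dDQ i; simp [hR]; tauto
  have dQR : Disjoint Q R := disjoint_right.2 fun i hi => (rR i hi).2.2
  have dPR : Disjoint P R := disjoint_right.2 fun i hi => (rR i hi).2.1
  have hx1 : (∏ i ∈ P, x i) ^ #Q * (∏ i ∈ Q, x i) ^ #P * qsT q x P Q =
      (∏ i ∈ P, ∏ j ∈ Q, x i / (x i - x j)) * ∏ i ∈ Q, ∏ j ∈ P, x i / (x i - q * x j) := by
    rw [prod_comm (s := Q) (t := P), ← prod_mul_distrib, qsT, ← prod_pow, ← prod_const,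
      ← prod_mul_distrib, ← prod_mul_distrib]
    refine prod_congr rfl fun i _ => ?_
    rw [← prod_const, ← prod_mul_distrib, ← prod_mul_distrib, ← prod_mul_distrib]
    refine prod_congr rfl fun j _ => ?_
    rw [qsG, mul_inv, div_eq_mul_inv, div_eq_mul_inv]; ring
  rw [hx1, qsA, qsA, map_prod]
  simp only [map_prod, map_div₀, map_sub]
  rw [c1, c2, qs_bil_left _ _ _ _ hDP, qs_bil_right _ _ _ _ dQR, qs_bil_right _ _ _ _ dQR,
    qs_bil_left _ _ _ _ hDQ, qs_bil_right _ _ _ _ dPR, qs_bil_right _ _ _ _ dPR,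
    qsCom, ← hR, qs_bil_right _ _ _ _ hPQ, qs_bil_left _ _ _ _ hPQ]
  have t1 : ∏ i ∈ D, ∏ j ∈ P, γ (D ∪ P) (x i) / (γ (D ∪ P) (x i) - γ (D ∪ P) (x j)) =
      ∏ i ∈ D, ∏ j ∈ P, x i / (x i - x j) := by
    refine prod_congr rfl fun i hi => prod_congr rfl fun j hj => ?_
    simp only [hγ, mem_union, hi, hj, true_or, or_true, if_true]
    rw [← mul_sub, mul_div_mul_left _ _ hq]
  have t2 : ∏ i ∈ D, ∏ j ∈ R, γ (D ∪ P) (x i) / (γ (D ∪ P) (x i) - γ (D ∪ P) (x j)) =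
      ∏ i ∈ D, ∏ j ∈ R, q * x i / (q * x i - x j) := by
    refine prod_congr rfl fun i hi => prod_congr rfl fun j hj => ?_
    simp [hγ, hi, rR j hj]
  have t3 : ∏ i ∈ Q, ∏ j ∈ P, γ (D ∪ P) (x i) / (γ (D ∪ P) (x i) - γ (D ∪ P) (x j)) =
      ∏ i ∈ Q, ∏ j ∈ P, x i / (x i - q * x j) := by
    refine prod_congr rfl fun i hi => prod_congr rfl fun j hj => ?_
    have n1 : i ∉ D := fun h => dDQ i h hi
    have n2 : i ∉ P := fun h => dPQ i h hi
    simp [hγ, hj, n1, n2]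
  have t4 : ∏ i ∈ Q, ∏ j ∈ R, γ (D ∪ P) (x i) / (γ (D ∪ P) (x i) - γ (D ∪ P) (x j)) =
      ∏ i ∈ Q, ∏ j ∈ R, x i / (x i - x j) := by
    refine prod_congr rfl fun i hi => prod_congr rfl fun j hj => ?_
    have n1 : i ∉ D := fun h => dDQ i h hi
    have n2 : i ∉ P := fun h => dPQ i h hi
    simp [hγ, rR j hj, n1, n2]
  rw [t1, t2, t3, t4]
  ring

/-- abstract operator -/
def qsM [Fintype ι] (x : ι → L) (γ : Finset ι → L ≃+* L) (a : ℕ) (k : ℤ) (f : L) : L :=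
  ∑ I ∈ powersetCard a univ, (∏ i ∈ I, x i) ^ k * (qsA x I * γ I f)

def qsZ [Fintype ι] (x : ι → L) (γ : Finset ι → L ≃+* L) (k l : ℤ) (f : L) (I J : Finset ι) : L :=
  (∏ i ∈ I, x i) ^ k * (γ I (∏ i ∈ J, x i)) ^ l * (qsA x I * γ I (qsA x J)) *
    γ (I ∪ J) (γ (I ∩ J) f)

lemma qs_comp [Fintype ι] (x : ι → L) (γ : Finset ι → L ≃+* L)
    (hγ2 : ∀ I J f, γ I (γ J f) = γ (I ∪ J) (γ (I ∩ J) f)) (a b : ℕ) (k l : ℤ) (f : L) :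
    qsM x γ a k (qsM x γ b l f) =
      ∑ I, ∑ J, if #I = a ∧ #J = b then qsZ x γ k l f I J else 0 := by
  have hc : ∀ c, powersetCard c (univ : Finset ι) = univ.filter (fun I => #I = c) := by
    intro c; ext I; simp [mem_powersetCard]
  unfold qsM
  rw [hc, hc, sum_filter]
  refine sum_congr rfl fun I _ => ?_
  by_cases hI : #I = a
  · simp only [hI, if_true, true_and]
    rw [map_sum, mul_sum, mul_sum, sum_filter]
    refine sum_congr rfl fun J _ => ?_
    split_ifs
    · rw [map_mul, map_mul, map_zpow₀, hγ2 I J f, qsZ]; ring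
    · rfl
  · simp [hI]

lemma qs_final [Fintype ι] (q : L) (x : ι → L) (hg : qsGen q x) (γ : Finset ι → L ≃+* L)
    (hγ : ∀ I i, γ I (x i) = if i ∈ I then q * x i else x i)
    (hγ2 : ∀ I J f, γ I (γ J f) = γ (I ∪ J) (γ (I ∩ J) f)) (a : ℕ) (ha : 1 ≤ a) (k : ℤ) (f : L) :
    q ^ (a : ℤ) * qsM x γ a (k + 1) (qsM x γ a (k - 1) f) =
      qsM x γ a k (qsM x γ a k f) - qsM x γ (a + 1) k (qsM x γ (a - 1) k f) := by
  have hq := hg.1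
  have hx0 : ∀ i, x i ≠ 0 := fun i h => hg.2.2 i i (by rw [h, mul_zero])
  simp only [qs_comp x γ hγ2]
  rw [eq_comm, ← sub_eq_zero, mul_sum, ← sum_sub_distrib, ← sum_sub_distrib]
  simp only [mul_sum, ← sum_sub_distrib]
  rw [qs_regroup]
  refine sum_eq_zero fun D _ => sum_eq_zero fun S hS => ?_
  rw [mem_powerset] at hS
  have hDS : Disjoint D S := disjoint_right.2 fun i hi => by simpa using hS hi
  by_cases hex : ∃ p, #S = 2 * p ∧ #D + p = a
  · obtain ⟨p, hp, hpa⟩ := hex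
    have hm := qs_main q x hg p S hp
    set Cst : L := qsCom q x D S * γ (D ∪ S) (γ D f) *
      (q ^ #D * (∏ i ∈ D, x i) ^ 2 * ∏ i ∈ S, x i) ^ k * (∏ i ∈ S, x i) ^ ((p : ℤ) - 1) with hCst
    refine Eq.trans ?_ (show Cst * ∑ P ∈ S.powerset, qsW q x p P (S \ P) * qsT q x P (S \ P) = 0 by
      rw [hm, mul_zero])
    rw [mul_sum]
    refine sum_congr rfl fun P hP => ?_
    rw [mem_powerset] at hP
    obtain ⟨Q, hQ⟩ : ∃ Q, Q = S \ P := ⟨_, rfl⟩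
    have hPQ : Disjoint P Q := hQ ▸ disjoint_sdiff
    have hS' : S = P ∪ Q := by rw [hQ, union_sdiff_of_subset hP]
    rw [← hQ]
    have hDP : Disjoint D P := hDS.mono_right hP
    have hDQ : Disjoint D Q := hDS.mono_right (hQ ▸ sdiff_subset)
    have cS : #P + #Q = 2 * p := by rw [← hp, hS', card_union_of_disjoint hPQ]
    have cI : #(D ∪ P) = #D + #P := card_union_of_disjoint hDP
    have cJ : #(D ∪ Q) = #D + #Q := card_union_of_disjoint hDQ
    have eU : (D ∪ P) ∪ (D ∪ Q) = D ∪ S := by rw [hS']; ext i; simp; tauto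
    have eI : (D ∪ P) ∩ (D ∪ Q) = D := by
      ext i; have := fun h : i ∈ P => disjoint_left.1 hPQ h; simp; tauto
    have hy : γ (D ∪ P) (∏ i ∈ D ∪ Q, x i) = q ^ #D * (∏ i ∈ D, x i) * ∏ i ∈ Q, x i := by
      rw [map_prod, prod_union hDQ, ← prod_const, ← prod_mul_distrib]
      congr 1
      · exact prod_congr rfl fun i hi => by simp [hγ, hi]
      · refine prod_congr rfl fun i hi => ?_
        have h1 : i ∉ D := disjoint_right.1 hDQ hi
        have h2 : i ∉ P := disjoint_right.1 hPQ hi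
        simp [hγ, h1, h2]
    simp only [qsZ, eU, eI, hy, cI, cJ, prod_union hDP, qs_coeff q hq x γ hγ D P Q hDP hDQ hPQ]
    rw [hCst]
    have hSP : ∏ i ∈ S, x i = (∏ i ∈ P, x i) * ∏ i ∈ Q, x i := by rw [hS', prod_union hPQ]
    rw [hSP, ← hS']
    have uD : ∏ i ∈ D, x i ≠ 0 := prod_ne_zero_iff.2 fun i _ => hx0 i
    have uP : ∏ i ∈ P, x i ≠ 0 := prod_ne_zero_iff.2 fun i _ => hx0 i
    have uQ : ∏ i ∈ Q, x i ≠ 0 := prod_ne_zero_iff.2 fun i _ => hx0 i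
    have uq : q ^ #D ≠ 0 := pow_ne_zero _ hq
    have ea : q ^ (a : ℤ) = q ^ #D * q ^ p := by rw [zpow_natCast, ← hpa, pow_add]
    rw [ea]
    unfold qsW
    generalize ∏ i ∈ D, x i = d at *
    generalize ∏ i ∈ P, x i = u at *
    generalize ∏ i ∈ Q, x i = v at *
    generalize q ^ #D = e at *
    generalize qsCom q x D S = c
    generalize qsT q x P Q = T
    generalize γ (D ∪ S) (γ D f) = F
    rw [zpow_sub_one₀ (mul_ne_zero uP uQ), zpow_natCast, zpow_add_one₀ (mul_ne_zero uD uP),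
      zpow_sub_one₀ (mul_ne_zero (mul_ne_zero uq uD) uQ)]
    have hk : (e * d ^ 2 * (u * v)) ^ k = (d * u) ^ k * (e * d * v) ^ k := by
      rw [← mul_zpow]; congr 1; ring
    rw [hk]
    generalize (d * u) ^ k = X1
    generalize (e * d * v) ^ k = X2
    by_cases h1 : #P = p
    · have h2 : #Q = p := by omega
      have h3 : #D + #P = a := by omega
      have h4 : #D + #Q = a := by omega
      have h5 : ¬ (#D + #P = a + 1) := by omega
      have m1 : #D + #P = a ∧ #D + #Q = a := ⟨h3, h4⟩
      have m2 : ¬ (#D + #P = a + 1 ∧ #D + #Q = a - 1) := fun h => h5 h.1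
      simp only [if_pos m1, if_neg m2, if_pos h1]
      rw [h1, h2]
      field_simp
      ring
    · by_cases h2 : #P = p + 1
      · obtain ⟨r, rfl⟩ : ∃ r, p = r + 1 := ⟨p - 1, by omega⟩
        have h3 : ¬ (#D + #P = a) := by omega
        have h4 : #D + #P = a + 1 := by omega
        have h5 : #D + #Q = a - 1 := by omega
        have h6 : #Q = r := by omega
        have m1 : ¬ (#D + #P = a ∧ #D + #Q = a) := fun h => h3 h.1
        have m2 : #D + #P = a + 1 ∧ #D + #Q = a - 1 := ⟨h4, h5⟩
        simp only [if_neg m1, if_pos m2, if_neg h1, if_pos h2]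
        rw [h2, h6]
        field_simp
        ring
      · have h3 : ¬ (#D + #P = a) := by omega
        have h4 : ¬ (#D + #P = a + 1) := by omega
        have m1 : ¬ (#D + #P = a ∧ #D + #Q = a) := fun h => h3 h.1
        have m2 : ¬ (#D + #P = a + 1 ∧ #D + #Q = a - 1) := fun h => h4 h.1
        simp only [if_neg m1, if_neg m2, if_neg h1, if_neg h2]
        ring
  · refine sum_eq_zero fun P hP => ?_
    rw [mem_powerset] at hP
    have cS : #P + #(S \ P) = #S := by
      rw [card_sdiff_of_subset hP]; have := card_le_card hP; omega
    have cI : #(D ∪ P) = #D + #P := card_union_of_disjoint (hDS.mono_right hP)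
    have cJ : #(D ∪ (S \ P)) = #D + #(S \ P) := card_union_of_disjoint (hDS.mono_right sdiff_subset)
    rw [cI, cJ]
    have h1 : ¬ (#D + #P = a ∧ #D + #(S \ P) = a) := fun h => hex ⟨#P, by omega, by omega⟩
    have h2 : ¬ (#D + #P = a + 1 ∧ #D + #(S \ P) = a - 1) :=
      fun h => hex ⟨#P - 1, by omega, by omega⟩
    simp [h1, h2]

end QSys

end


lemma qs_Γ_algebraMap (N : ℕ) (v : Fin N → ℤ) (p : Pol N) :
    Γ N v (algebraMap (Pol N) (K N) p) = algebraMap (Pol N) (K N) (shiftHom N v p) := by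
  unfold Γ
  rw [IsFractionRing.ringEquivOfRingEquiv_algebraMap]
  rfl

lemma qs_Γ_add (N : ℕ) (v w : Fin N → ℤ) (f : K N) : Γ N v (Γ N w f) = Γ N (v + w) f := by
  have hp : ∀ p : Pol N, shiftHom N v (shiftHom N w p) = shiftHom N (v + w) p := by
    intro p
    have : (shiftHom N v).comp (shiftHom N w) = shiftHom N (v + w) := by
      apply MvPolynomial.algHom_ext
      intro j
      simp only [shiftHom, AlgHom.comp_apply, MvPolynomial.aeval_X, map_mul,
        MvPolynomial.algHom_C, Pi.add_apply]
      rw [MvPolynomial.algebraMap_eq, ← mul_assoc, ← MvPolynomial.C_mul,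
        zpow_add₀ sq_ne_zero, mul_comm (sQ ^ w j)]
    rw [← this]; rfl
  obtain ⟨a, b, _, rfl⟩ := IsFractionRing.div_surjective (A := Pol N) f
  simp only [map_div₀, qs_Γ_algebraMap, hp]

lemma qs_ΓA_x (N : ℕ) (I : Finset (Fin N)) (i : Fin N) :
    ΓA N (fun i => if i ∈ I then 1 else 0) (xA N i) =
      if i ∈ I then qK N * xA N i else xA N i := by
  unfold ΓA xA y qK
  rw [qs_Γ_algebraMap]
  simp only [shiftHom, MvPolynomial.aeval_X]
  split_ifs with h
  · rw [← map_mul]; simp [h, qq]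
  · simp [h]

lemma qs_ΓA_comp (N : ℕ) (I J : Finset (Fin N)) (f : K N) :
    ΓA N (fun i => if i ∈ I then 1 else 0) (ΓA N (fun i => if i ∈ J then 1 else 0) f) =
    ΓA N (fun i => if i ∈ I ∪ J then 1 else 0) (ΓA N (fun i => if i ∈ I ∩ J then 1 else 0) f) := by
  unfold ΓA
  rw [qs_Γ_add, qs_Γ_add]
  congr 2
  funext i
  by_cases h1 : i ∈ I <;> by_cases h2 : i ∈ J <;> simp [h1, h2]

lemma qs_qq_ne_one : qq ≠ 1 := by
  unfold qq sQ
  intro h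
  have h1 : (algebraMap (Polynomial ℚ) (RatFunc ℚ)) (Polynomial.X ^ 2) =
      algebraMap (Polynomial ℚ) (RatFunc ℚ) 1 := by
    rw [map_pow, RatFunc.algebraMap_X, map_one, h]
  have h2 := RatFunc.algebraMap_injective ℚ h1
  have h3 := congrArg (Polynomial.eval 2) h2
  norm_num at h3

lemma qs_gen (N : ℕ) : qsGen (qK N) (xA N) := by
  have hinj : Function.Injective (algebraMap (Pol N) (K N)) := IsFractionRing.injective _ _
  refine ⟨?_, ?_, ?_⟩
  · unfold qK
    intro h
    have h1 : (MvPolynomial.C qq : Pol N) = 0 := hinj (by rw [h, map_zero])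
    rw [MvPolynomial.C_eq_zero] at h1
    exact pow_ne_zero 2 sq_ne_zero h1
  · intro i j h
    exact MvPolynomial.X_injective (hinj h)
  · intro i j h
    unfold xA y qK at h
    rw [← map_mul] at h
    have h1 := hinj h
    by_cases hij : i = j
    · subst hij
      have h2 := congrArg (MvPolynomial.eval (fun _ => (1 : Rq))) h1
      simp at h2
      exact qs_qq_ne_one h2.symm
    · have h2 := congrArg (MvPolynomial.eval (fun l => if l = i then (1 : Rq) else 0)) h1
      simp [Ne.symm hij] at h2

/-- the type `A_{N−1}` renormalized quantum Q-system
`q^a M_{a,k+1} ∘ M_{a,k−1} = M_{a,k} ∘ M_{a,k} − M_{a+1,k} ∘ M_{a−1,k}`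
for all `a ∈ {1,…,N−1}` and `k ∈ ℤ` (here `M_{0,k}` is the identity operator, which agrees
with the defining formula of `M` at `a = 0`). -/
theorem stmt0 (N : ℕ) (a : ℕ) (ha : 1 ≤ a) (ha' : a ≤ N - 1) (k : ℤ) :
    (qK N ^ (a : ℤ)) • (MA N a (k + 1) ∘ MA N a (k - 1)) =
      MA N a k ∘ MA N a k - MA N (a + 1) k ∘ MA N (a - 1) k := by
  funext f
  have h := qs_final (qK N) (xA N) (qs_gen N) (fun I => ΓA N (fun i => if i ∈ I then 1 else 0))
    (qs_ΓA_x N) (qs_ΓA_comp N) a ha k f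
  exact h
end
end

section
/- With M_{a,k} = Σ_{|I|=a} (Π_{i∈I} x_i)^k Π_{i∈I,j∉I} x_i/(x_i−x_j) Π_{i∈I} Γ_i acting on rational functions of x_1,...,x_N, for all a,b ∈ {1,...,N} and k,k' ∈ ℤ with |k−k'| ≤ |a−b|+1, one has M_{a,k} ∘ M_{b,k'} = q^{(k'−k)·min(a,b)} · M_{b,k'} ∘ M_{a,k}. -/
noncomputable section

section PhiSection

variable {ι R : Type*} [DecidableEq ι] [CommRing R]

/-- Symmetrized sum over splittings `T = I ⊔ (T \ I)`, `|I| = n`. -/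
def Phi (g : ι → ι → R) (T : Finset ι) (n : ℕ) (a b : ι → R) : R :=
  ∑ I ∈ Finset.powersetCard n T,
    (∏ i ∈ I, a i) * (∏ j ∈ T \ I, b j) * ∏ i ∈ I, ∏ j ∈ T \ I, g i j

lemma Phi_insert (g : ι → ι → R) (T : Finset ι) (n : ℕ) (a b : ι → R) (o : ι) (ho : o ∉ T) :
    Phi g (insert o T) (n + 1) a b =
      b o * Phi g T (n + 1) (fun i => a i * g i o) b +
      a o * Phi g T n a (fun j => b j * g o j) := by
  unfold Phi
  rw [Finset.powersetCard_succ_insert ho, Finset.sum_union, Finset.sum_image]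
  · rw [Finset.mul_sum, Finset.mul_sum]
    congr 1
    · apply Finset.sum_congr rfl
      intro I hI
      rw [Finset.mem_powersetCard] at hI
      have hoI : o ∉ I := fun h => ho (hI.1 h)
      have hs : insert o T \ I = insert o (T \ I) := Finset.insert_sdiff_of_notMem _ hoI
      have ho' : o ∉ T \ I := fun h => ho (Finset.mem_sdiff.1 h).1
      rw [hs, Finset.prod_insert ho', Finset.prod_mul_distrib]
      simp_rw [Finset.prod_insert ho']
      rw [Finset.prod_mul_distrib]
      ring
    · apply Finset.sum_congr rfl
      intro I hI
      rw [Finset.mem_powersetCard] at hI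
      have hoI : o ∉ I := fun h => ho (hI.1 h)
      have hs : insert o T \ insert o I = T \ I := by
        ext t; simp only [Finset.mem_sdiff, Finset.mem_insert]
        constructor
        · rintro ⟨h1, h2⟩; tauto
        · rintro ⟨h1, h2⟩
          refine ⟨Or.inr h1, ?_⟩
          rintro (h | h)
          · exact ho (h ▸ h1)
          · exact h2 h
      rw [hs, Finset.prod_insert hoI, Finset.prod_insert hoI, Finset.prod_mul_distrib]
      ring
  · intro I hI J hJ h
    simp only [Finset.mem_coe, Finset.mem_powersetCard] at hI hJ
    have hoI : o ∉ I := fun h => ho (hI.1 h)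
    have hoJ : o ∉ J := fun h => ho (hJ.1 h)
    rw [← Finset.erase_insert hoI, ← Finset.erase_insert hoJ, h]
  · rw [Finset.disjoint_left]
    intro I hI hI'
    rw [Finset.mem_powersetCard] at hI
    obtain ⟨J, _, rfl⟩ := Finset.mem_image.1 hI'
    exact ho (hI.1 (Finset.mem_insert_self _ _))

lemma Phi_insert_zero (g : ι → ι → R) (T : Finset ι) (a b : ι → R) (o : ι) (ho : o ∉ T) :
    Phi g (insert o T) 0 a b = b o * Phi g T 0 (fun i => a i * g i o) b := by
  simp [Phi, Finset.prod_insert ho]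

lemma Phi_insert_a (g : ι → ι → R) (T : Finset ι) (n : ℕ) (a b : ι → R) (o : ι) (ho : o ∉ T)
    (h : a o = 0) :
    Phi g (insert o T) n a b = b o * Phi g T n (fun i => a i * g i o) b := by
  cases n with
  | zero => exact Phi_insert_zero g T a b o ho
  | succ n => rw [Phi_insert g T n a b o ho, h]; ring

lemma Phi_insert_b (g : ι → ι → R) (T : Finset ι) (n : ℕ) (a b : ι → R) (o : ι) (ho : o ∉ T)
    (h : b o = 0) :
    Phi g (insert o T) (n + 1) a b = a o * Phi g T n a (fun j => b j * g o j) := by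
  rw [Phi_insert g T n a b o ho, h]; ring

lemma Phi_congr (g g' : ι → ι → R) (T : Finset ι) (n : ℕ) (a b a' b' : ι → R)
    (hg : ∀ i ∈ T, ∀ j ∈ T, i ≠ j → g i j = g' i j)
    (ha : ∀ i ∈ T, a i = a' i) (hb : ∀ i ∈ T, b i = b' i) :
    Phi g T n a b = Phi g' T n a' b' := by
  unfold Phi
  apply Finset.sum_congr rfl
  intro I hI
  rw [Finset.mem_powersetCard] at hI
  congr 1
  · congr 1
    · exact Finset.prod_congr rfl fun i hi => ha i (hI.1 hi)
    · exact Finset.prod_congr rfl fun i hi => hb i (Finset.mem_sdiff.1 hi).1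
  · refine Finset.prod_congr rfl fun i hi => Finset.prod_congr rfl fun j hj => ?_
    rw [Finset.mem_sdiff] at hj
    exact hg i (hI.1 hi) j hj.1 (fun h => hj.2 (h ▸ hi))

lemma Phi_scale (g : ι → ι → R) (T : Finset ι) (n : ℕ) (a b c : ι → R) (u v : R) :
    Phi g T n (fun i => a i * (u * c i)) (fun j => b j * (v * c j)) =
      u ^ n * v ^ (T.card - n) * (∏ t ∈ T, c t) * Phi g T n a b := by
  unfold Phi
  rw [Finset.mul_sum]
  apply Finset.sum_congr rfl
  intro I hI
  rw [Finset.mem_powersetCard] at hI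
  rw [← Finset.prod_sdiff hI.1]
  simp only [Finset.prod_mul_distrib, Finset.prod_const, hI.2, Finset.card_sdiff_of_subset hI.1]
  ring

lemma Phi_map {R' : Type*} [CommRing R'] (φ : R →+* R') (g : ι → ι → R) (T : Finset ι) (n : ℕ)
    (a b : ι → R) :
    φ (Phi g T n a b) =
      Phi (fun i j => φ (g i j)) T n (fun i => φ (a i)) (fun i => φ (b i)) := by
  simp [Phi, map_sum, map_mul, map_prod]

lemma Phi_natDegree (g : ι → ι → R) (T : Finset ι) (n da db : ℕ) (a b : ι → Polynomial R)
    (ha : ∀ i, (a i).natDegree ≤ da) (hb : ∀ i, (b i).natDegree ≤ db) :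
    (Phi (fun i j => Polynomial.C (g i j)) T n a b).natDegree ≤ n * da + (T.card - n) * db := by
  unfold Phi
  apply Polynomial.natDegree_sum_le_of_forall_le
  intro I hI
  rw [Finset.mem_powersetCard] at hI
  have h1 : (∏ i ∈ I, a i).natDegree ≤ n * da := by
    refine (Polynomial.natDegree_prod_le _ _).trans ?_
    refine (Finset.sum_le_card_nsmul _ _ da fun i _ => ha i).trans ?_
    simp [hI.2]
  have h2 : (∏ i ∈ T \ I, b i).natDegree ≤ (T.card - n) * db := by
    refine (Polynomial.natDegree_prod_le _ _).trans ?_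
    refine (Finset.sum_le_card_nsmul _ _ db fun i _ => hb i).trans ?_
    simp [hI.2, Finset.card_sdiff_of_subset hI.1]
  have h3 : (∏ i ∈ I, ∏ j ∈ T \ I, Polynomial.C (g i j)).natDegree = 0 := by
    simp_rw [← map_prod]
    exact Polynomial.natDegree_C _
  calc _ ≤ _ := Polynomial.natDegree_mul_le
    _ ≤ ((∏ i ∈ I, a i).natDegree + (∏ i ∈ T \ I, b i).natDegree) + 0 := by
      rw [h3]; exact Nat.add_le_add_right Polynomial.natDegree_mul_le _
    _ ≤ _ := by omega

/-- The combination obtained from splitting off one point with coordinate `z`. -/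
def PF (g : ι → ι → R) (T : Finset ι) (n e s : ℕ) (x A B E : ι → R) (z : R) : R :=
  z ^ s * Phi g T (n + 1) (fun i => x i ^ e * A i) (fun j => x j ^ s * E j) +
  z ^ e * Phi g T n (fun i => x i ^ e * E i) (fun j => x j ^ s * B j)

lemma PF_same (g : ι → ι → R) (T : Finset ι) (n e s : ℕ) (x A B E : ι → R) (l : ι) (hl : l ∉ T)
    (hE : E l = 0) (hAB : A l + B l = 0) (hA : ∀ i ∈ T, E i * g i l = A i)
    (hB : ∀ i ∈ T, E i * g l i = B i) :
    PF g (insert l T) n e s x A B E (x l) = 0 := by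
  unfold PF
  rw [Phi_insert_b _ _ _ _ _ _ hl (by simp [hE]), Phi_insert_a _ _ _ _ _ _ hl (by simp [hE])]
  rw [Phi_congr g g T n (fun i => x i ^ e * A i) (fun j => x j ^ s * E j * g l j)
    (fun i => x i ^ e * A i) (fun j => x j ^ s * B j) (fun _ _ _ _ _ => rfl) (fun _ _ => rfl)
    (fun i hi => by rw [← hB i hi]; ring)]
  rw [Phi_congr g g T n (fun i => x i ^ e * E i * g i l) (fun j => x j ^ s * B j)
    (fun i => x i ^ e * A i) (fun j => x j ^ s * B j) (fun _ _ _ _ _ => rfl)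
    (fun i hi => by rw [← hA i hi]; ring) (fun _ _ => rfl)]
  rw [eq_neg_of_add_eq_zero_left hAB]
  ring

lemma PF_B (g : ι → ι → R) (T : Finset ι) (n e s : ℕ) (x A B E : ι → R) (l : ι) (hl : l ∉ T)
    (z u : R) (hE : E l = 0) (hB : B l = 0) (hA : ∀ i ∈ T, E i * g l i = u * A i) :
    PF g (insert l T) n e s x A B E z =
      z ^ s * x l ^ e * A l * u ^ (T.card - n) * (∏ t ∈ T, A t) *
        Phi g T n (fun i => x i ^ e) (fun i => x i ^ s) := by
  unfold PF
  rw [Phi_insert_b _ _ _ _ _ _ hl (by simp [hE]), Phi_insert_a _ _ _ _ _ _ hl (by simp [hE])]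
  rw [Phi_congr g g T n (fun i => x i ^ e * A i) (fun j => x j ^ s * E j * g l j)
    (fun i => x i ^ e * (1 * A i)) (fun j => x j ^ s * (u * A j)) (fun _ _ _ _ _ => rfl)
    (fun _ _ => by ring)
    (fun i hi => by rw [← hA i hi]; ring), Phi_scale, hB]
  ring

lemma PF_A (g : ι → ι → R) (T : Finset ι) (n e s : ℕ) (x A B E : ι → R) (l : ι) (hl : l ∉ T)
    (z u : R) (hE : E l = 0) (hA : A l = 0) (hB : ∀ i ∈ T, E i * g i l = u * B i) :
    PF g (insert l T) n e s x A B E z =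
      z ^ e * x l ^ s * B l * u ^ n * (∏ t ∈ T, B t) *
        Phi g T n (fun i => x i ^ e) (fun i => x i ^ s) := by
  unfold PF
  rw [Phi_insert_b _ _ _ _ _ _ hl (by simp [hE]), Phi_insert_a _ _ _ _ _ _ hl (by simp [hE])]
  rw [Phi_congr g g T n (fun i => x i ^ e * E i * g i l) (fun j => x j ^ s * B j)
    (fun i => x i ^ e * (u * B i)) (fun j => x j ^ s * (1 * B j)) (fun _ _ _ _ _ => rfl)
    (fun i hi => by rw [← hB i hi]; ring) (fun _ _ => by ring), Phi_scale, hA]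
  ring

lemma PF_total (g : ι → ι → R) (T : Finset ι) (n e s : ℕ) (x A B E : ι → R) (o : ι) (ho : o ∉ T)
    (hA : ∀ i ∈ T, E i * g i o = A i) (hB : ∀ i ∈ T, E i * g o i = B i) :
    PF g T n e s x A B E (x o) =
      (∏ t ∈ T, E t) * Phi g (insert o T) (n + 1) (fun i => x i ^ e) (fun i => x i ^ s) := by
  unfold PF
  rw [Phi_insert _ _ _ _ _ _ ho]
  rw [Phi_congr g g T (n+1) (fun i => x i ^ e * A i) (fun j => x j ^ s * E j)
    (fun i => (x i ^ e * g i o) * (1 * E i)) (fun j => x j ^ s * (1 * E j))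
    (fun _ _ _ _ _ => rfl)
    (fun i hi => by rw [← hA i hi]; ring) (fun _ _ => by ring), Phi_scale]
  rw [Phi_congr g g T n (fun i => x i ^ e * E i) (fun j => x j ^ s * B j)
    (fun i => x i ^ e * (1 * E i)) (fun j => (x j ^ s * g o j) * (1 * E j))
    (fun _ _ _ _ _ => rfl) (fun _ _ => by ring)
    (fun i hi => by rw [← hB i hi]; ring), Phi_scale]
  ring

lemma PF_map {R' : Type*} [CommRing R'] (φ : R →+* R') (g : ι → ι → R) (T : Finset ι) (n e s : ℕ)
    (x A B E : ι → R) (z : R) :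
    φ (PF g T n e s x A B E z) =
      PF (fun i j => φ (g i j)) T n e s (fun i => φ (x i)) (fun i => φ (A i)) (fun i => φ (B i))
        (fun i => φ (E i)) (φ z) := by
  unfold PF
  simp only [map_add, map_mul, map_pow, Phi_map]

end PhiSection

section KeySection

variable {ι k : Type*} [DecidableEq ι] [Field k]

/-- The kernel `1 / ((x_i - x_j) (x_j - q x_i))`. -/
def gk (q : k) (x : ι → k) (i j : ι) : k := ((x i - x j) * (x j - q * x i))⁻¹

lemma PF_natDegree (g : ι → ι → k) (T : Finset ι) (n e s D : ℕ) (x : ι → k)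
    (A B E : ι → Polynomial k)
    (hA : ∀ i, (A i).natDegree ≤ 1) (hB : ∀ i, (B i).natDegree ≤ 1)
    (hE : ∀ i, (E i).natDegree ≤ 3)
    (h1 : s + ((n + 1) * 1 + (T.card - (n + 1)) * 3) ≤ D)
    (h2 : e + (n * 3 + (T.card - n) * 1) ≤ D) :
    (PF (fun i j => Polynomial.C (g i j)) T n e s (fun i => Polynomial.C (x i)) A B E
      Polynomial.X).natDegree ≤ D := by
  have hc : ∀ (F : ι → Polynomial k) (d m : ℕ), (∀ i, (F i).natDegree ≤ d) →
      ∀ i, (Polynomial.C (x i) ^ m * F i).natDegree ≤ d := by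
    intro F d m hF i
    rw [← map_pow]
    exact (Polynomial.natDegree_C_mul_le _ _).trans (hF i)
  unfold PF
  apply Polynomial.natDegree_add_le_of_degree_le
  · refine le_trans (Polynomial.natDegree_mul_le.trans (Nat.add_le_add
      (Polynomial.natDegree_X_pow_le s) (Phi_natDegree g T (n+1) 1 3 _ _ (hc A 1 e hA)
        (hc E 3 s hE)))) h1
  · refine le_trans (Polynomial.natDegree_mul_le.trans (Nat.add_le_add
      (Polynomial.natDegree_X_pow_le e) (Phi_natDegree g T n 3 1 _ _ (hc E 3 e hE)
        (hc B 1 s hB)))) h2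

lemma key_identity (q : k) (x : ι → k) (hq0 : q ≠ 0) (hq1 : q ≠ 1) (hq2 : q ^ 2 ≠ 1)
    (hx0 : ∀ i, x i ≠ 0) (hx1 : ∀ i j, i ≠ j → x i ≠ x j) (hx2 : ∀ i j, i ≠ j → x i ≠ q * x j)
    (hx3 : ∀ i j, i ≠ j → x i ≠ q ^ 2 * x j) (d e s : ℕ) (he : e ≤ 1) (hs : s ≤ 2 * d + 1)
    (β : ℕ) : ∀ S : Finset ι, S.card = 2 * β + d →
    q ^ ((e + d) * β) * Phi (gk q x) S (β + d) (fun i => x i ^ e) (fun i => x i ^ s) =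
    q ^ (s * β) * Phi (fun i j => gk q x j i) S (β + d) (fun i => x i ^ e) (fun i => x i ^ s) := by
  induction β with
  | zero =>
    intro S hS
    have hS' : S.card = 0 + d := by omega
    unfold Phi
    rw [← hS', Finset.powersetCard_self]
    simp
  | succ β ih =>
    intro S hS
    obtain ⟨o, hoS⟩ : S.Nonempty := by
      rw [← Finset.card_pos]; omega
    obtain ⟨T, ho, rfl⟩ : ∃ T, o ∉ T ∧ insert o T = S :=
      ⟨S.erase o, Finset.notMem_erase _ _, Finset.insert_erase hoS⟩
    rw [Finset.card_insert_of_notMem ho] at hS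
    have hT : T.card = 2 * β + 1 + d := by omega
    -- the polynomials
    set A : ι → Polynomial k := fun l => Polynomial.C (x l) - Polynomial.C q * Polynomial.X with hA
    set B : ι → Polynomial k := fun l => Polynomial.C (q * x l) - Polynomial.X with hB
    set E : ι → Polynomial k := fun l => (Polynomial.X - Polynomial.C (x l)) * A l * B l with hE
    set g := gk q x with hg
    set P : Polynomial k :=
      Polynomial.C (q ^ ((e + d) * (β + 1))) *
        PF (fun i j => Polynomial.C (g i j)) T (β + d) e s (fun i => Polynomial.C (x i)) A B E
          Polynomial.X -
      Polynomial.C (q ^ (s * (β + 1))) *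
        PF (fun i j => Polynomial.C (g j i)) T (β + d) e s (fun i => Polynomial.C (x i)) B A E
          Polynomial.X with hP
    have hAd : ∀ i, (A i).natDegree ≤ 1 := by intro i; simp only [hA]; compute_degree
    have hBd : ∀ i, (B i).natDegree ≤ 1 := by intro i; simp only [hB]; compute_degree
    have hEd : ∀ i, (E i).natDegree ≤ 3 := by
      intro i; simp only [hE, hA, hB]; compute_degree
    have hdeg : P.natDegree ≤ 3 * T.card - 1 := by
      rw [← max_self (3 * T.card - 1)]
      apply Polynomial.natDegree_sub_le_of_le
      · refine (Polynomial.natDegree_C_mul_le _ _).trans (PF_natDegree _ _ _ _ _ _ _ _ _ _ hAd hBd hEd ?_ ?_)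
        · omega
        · omega
      · refine (Polynomial.natDegree_C_mul_le _ _).trans (PF_natDegree (fun i j => g j i) _ _ _ _ _ _ _ _ _ hBd hAd hEd ?_ ?_)
        · omega
        · omega
    let Az : k → ι → k := fun z l => x l - q * z
    let Bz : k → ι → k := fun z l => q * x l - z
    let Ez : k → ι → k := fun z l => (z - x l) * (x l - q * z) * (q * x l - z)
    have heval : ∀ z, P.eval z =
        q ^ ((e + d) * (β + 1)) * PF g T (β + d) e s x (Az z) (Bz z) (Ez z) z -
        q ^ (s * (β + 1)) * PF (fun i j => g j i) T (β + d) e s x (Bz z) (Az z) (Ez z) z := by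
      intro z
      rw [← Polynomial.coe_evalRingHom, hP, map_sub, map_mul, map_mul, PF_map, PF_map]
      simp [hA, hB, hE, Az, Bz, Ez]
    -- kernel nonvanishing facts
    have n1 : ∀ i j, i ≠ j → x i - x j ≠ 0 := fun i j h => sub_ne_zero.2 (hx1 i j h)
    have n2 : ∀ i j, i ≠ j → x i - q * x j ≠ 0 := fun i j h => sub_ne_zero.2 (hx2 i j h)
    have cA : ∀ o i, i ≠ o → Ez (x o) i * g i o = Az (x o) i := by
      intro o i h
      have := n1 i o h
      have := n2 o i h.symm
      simp only [Ez, Az, hg, gk]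
      rw [mul_inv_eq_iff_eq_mul₀ (by apply mul_ne_zero <;> assumption)]
      ring
    have cB : ∀ o i, i ≠ o → Ez (x o) i * g o i = Bz (x o) i := by
      intro o i h
      have := n1 o i h.symm
      have := n2 i o h
      simp only [Ez, Bz, hg, gk]
      rw [mul_inv_eq_iff_eq_mul₀ (by apply mul_ne_zero <;> assumption)]
      ring
    have root1 : ∀ l ∈ T, P.eval (x l) = 0 := by
      intro l hl
      obtain ⟨T0, hl0, rfl⟩ : ∃ T0, l ∉ T0 ∧ insert l T0 = T :=
        ⟨T.erase l, Finset.notMem_erase _ _, Finset.insert_erase hl⟩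
      have hne : ∀ i ∈ T0, i ≠ l := fun i hi h => hl0 (h ▸ hi)
      rw [heval, PF_same g T0 _ _ _ x _ _ _ l hl0, PF_same (fun i j => g j i) T0 _ _ _ x _ _ _ l hl0]
      · ring
      · simp [Ez]
      · simp only [Az, Bz]; ring
      · exact fun i hi => cB l i (hne i hi)
      · exact fun i hi => cA l i (hne i hi)
      · simp [Ez]
      · simp only [Az, Bz]; ring
      · exact fun i hi => cA l i (hne i hi)
      · exact fun i hi => cB l i (hne i hi)
    have root2 : ∀ l ∈ T, P.eval (q * x l) = 0 := by
      intro l hl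
      obtain ⟨T0, hl0, rfl⟩ : ∃ T0, l ∉ T0 ∧ insert l T0 = T :=
        ⟨T.erase l, Finset.notMem_erase _ _, Finset.insert_erase hl⟩
      have hne : ∀ i ∈ T0, i ≠ l := fun i hi h => hl0 (h ▸ hi)
      rw [Finset.card_insert_of_notMem hl0] at hT
      have c2 : ∀ i ∈ T0, Ez (q * x l) i * g l i = q * Az (q * x l) i := by
        intro i hi
        have := n1 l i (hne i hi).symm
        have := n2 i l (hne i hi)
        simp only [Ez, Az, hg, gk]
        field_simp
        ring
      rw [heval, PF_B g T0 _ _ _ x _ _ _ l hl0 _ q (by simp [Ez]) (by simp [Bz]) c2,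
        PF_A (fun i j => g j i) T0 _ _ _ x _ _ _ l hl0 _ q (by simp [Ez]) (by simp [Bz]) c2]
      have ih0 := ih T0 (by omega)
      have hc : T0.card - (β + d) = β := by omega
      rw [hc]
      linear_combination (q ^ (e + d + s + β) * x l ^ (e + s) * Az (q * x l) l *
        (∏ t ∈ T0, Az (q * x l) t)) * ih0
    have root3 : ∀ l ∈ T, P.eval (q⁻¹ * x l) = 0 := by
      intro l hl
      obtain ⟨T0, hl0, rfl⟩ : ∃ T0, l ∉ T0 ∧ insert l T0 = T :=
        ⟨T.erase l, Finset.notMem_erase _ _, Finset.insert_erase hl⟩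
      have hne : ∀ i ∈ T0, i ≠ l := fun i hi h => hl0 (h ▸ hi)
      rw [Finset.card_insert_of_notMem hl0] at hT
      have c2 : ∀ i ∈ T0, Ez (q⁻¹ * x l) i * g i l = q⁻¹ * Bz (q⁻¹ * x l) i := by
        intro i hi
        have := n1 i l (hne i hi)
        have := n2 l i (hne i hi).symm
        simp only [Ez, Bz, hg, gk]
        field_simp
      have hAl : Az (q⁻¹ * x l) l = 0 := by simp [Az, mul_inv_cancel_left₀ hq0]
      have hEl : Ez (q⁻¹ * x l) l = 0 := by
        have : x l - q * (q⁻¹ * x l) = 0 := hAl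
        simp only [Ez, this]; ring
      rw [heval, PF_A g T0 _ _ _ x _ _ _ l hl0 _ q⁻¹ hEl hAl c2,
        PF_B (fun i j => g j i) T0 _ _ _ x _ _ _ l hl0 _ q⁻¹ hEl hAl c2]
      have ih0 := ih T0 (by omega)
      have hc : T0.card - (β + d) = β := by omega
      rw [hc]
      have e1 : q ^ ((e + d) * (β + 1)) * (q⁻¹ ^ e * q⁻¹ ^ (β + d)) =
          q⁻¹ ^ β * q ^ ((e + d) * β) := by
        simp only [inv_pow]
        field_simp
        ring
      have e2 : q ^ (s * (β + 1)) * (q⁻¹ ^ s * q⁻¹ ^ β) =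
          q⁻¹ ^ β * q ^ (s * β) := by
        simp only [inv_pow]
        field_simp
        ring
      simp only [mul_pow]
      set F0 := Phi g T0 (β + d) (fun i => x i ^ e) (fun i => x i ^ s)
      set G0 := Phi (fun i j => g j i) T0 (β + d) (fun i => x i ^ e) (fun i => x i ^ s)
      set Y := x l ^ (e + s) * Bz (q⁻¹ * x l) l * (∏ t ∈ T0, Bz (q⁻¹ * x l) t) with hY
      rw [pow_add] at hY
      have h1 : q ^ ((e + d) * (β + 1)) * (q⁻¹ ^ e * x l ^ e * x l ^ s * Bz (q⁻¹ * x l) l *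
          q⁻¹ ^ (β + d) * (∏ t ∈ T0, Bz (q⁻¹ * x l) t) * F0) =
          (q ^ ((e + d) * (β + 1)) * (q⁻¹ ^ e * q⁻¹ ^ (β + d))) * Y * F0 := by rw [hY]; ring
      have h2 : q ^ (s * (β + 1)) * (q⁻¹ ^ s * x l ^ s * x l ^ e * Bz (q⁻¹ * x l) l *
          q⁻¹ ^ β * (∏ t ∈ T0, Bz (q⁻¹ * x l) t) * G0) =
          (q ^ (s * (β + 1)) * (q⁻¹ ^ s * q⁻¹ ^ β)) * Y * G0 := by rw [hY]; ring
      rw [h1, h2, e1, e2]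
      linear_combination (q⁻¹ ^ β * Y) * ih0
    have hq2' : q * q ≠ 1 := by rwa [← sq]
    have cancel : ∀ c l, c * x l = x l → c = 1 := fun c l h =>
      mul_right_cancel₀ (hx0 l) (by rw [h, one_mul])
    have hP0 : P = 0 := by
      let pt : T × Fin 3 → k := fun p => ![x p.1, q * x p.1, q⁻¹ * x p.1] p.2
      apply Polynomial.eq_zero_of_natDegree_lt_card_of_eval_eq_zero P (f := pt)
      · have X01 : ∀ i j, x i ≠ q * x j := by
          intro i j h
          by_cases hij : i = j
          · subst hij; exact hq1 (cancel q i h.symm)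
          · exact hx2 i j hij h
        have X12 : ∀ i j, q * x i ≠ q⁻¹ * x j := by
          intro i j h
          have h' : x j = q ^ 2 * x i := by
            field_simp at h
            rw [← h]
          by_cases hij : j = i
          · subst hij; exact hq2 (cancel _ j h'.symm)
          · exact hx3 j i hij h'
        have X02 : ∀ i j, x i ≠ q⁻¹ * x j := by
          intro i j h
          apply X01 j i
          rw [h, mul_inv_cancel_left₀ hq0]
        have inj : ∀ i j, x i = x j → i = j := fun i j h => by
          by_contra hne; exact hx1 i j hne h
        rintro ⟨⟨i, hi⟩, a⟩ ⟨⟨j, hj⟩, b⟩ h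
        fin_cases a <;> fin_cases b <;> simp [pt] at h ⊢
        · exact inj _ _ h
        · exact X01 _ _ h
        · exact X02 _ _ h
        · exact X01 _ _ h.symm
        · rcases h with h | h
          · exact inj _ _ h
          · exact absurd h hq0
        · exact X12 _ _ h
        · exact X02 _ _ h.symm
        · exact X12 _ _ h.symm
        · rcases h with h | h
          · exact inj _ _ h
          · exact absurd h hq0
      · rintro ⟨⟨i, hi⟩, a⟩
        fin_cases a
        · exact root1 i hi
        · exact root2 i hi
        · exact root3 i hi
      · simp only [Fintype.card_prod, Fintype.card_coe, Fintype.card_fin]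
        omega
    have hne : ∀ i ∈ T, i ≠ o := fun i hi h => ho (h ▸ hi)
    have fin := heval (x o)
    rw [hP0, Polynomial.eval_zero,
      PF_total g T _ _ _ x _ _ _ o ho (fun i hi => cA o i (hne i hi)) (fun i hi => cB o i (hne i hi)),
      PF_total (fun i j => g j i) T _ _ _ x _ _ _ o ho (fun i hi => cB o i (hne i hi))
        (fun i hi => cA o i (hne i hi))] at fin
    have hprod : ∏ t ∈ T, Ez (x o) t ≠ 0 := by
      rw [Finset.prod_ne_zero_iff]
      intro t ht
      have h1 := n1 o t (hne t ht).symm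
      have h2 := n2 o t (hne t ht).symm
      have h3 := n2 t o (hne t ht)
      have h2' : q * x t - x o ≠ 0 := by rw [← neg_sub]; exact neg_ne_zero.2 h2
      exact mul_ne_zero (mul_ne_zero h1 h3) h2'
    have hn : β + 1 + d = β + d + 1 := by ring
    rw [hn]
    apply mul_left_cancel₀ hprod
    linear_combination -fin

end KeySection

section OpSection

variable (N : ℕ)

lemma shift_comp (v w : Fin N → ℤ) (p : Pol N) :
    shiftEquiv N v (shiftEquiv N w p) = shiftEquiv N (v + w) p := by
  have h : (shiftHom N v).comp (shiftHom N w) = shiftHom N (v + w) := by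
    apply MvPolynomial.algHom_ext
    intro j
    simp only [shiftHom, AlgHom.comp_apply, MvPolynomial.aeval_X, map_mul, Pi.add_apply,
      zpow_add₀ sq_ne_zero, MvPolynomial.aeval_C, MvPolynomial.algebraMap_eq]
    ring
  exact DFunLike.congr_fun h p

lemma Γ_algebraMap (v : Fin N → ℤ) (p : Pol N) :
    Γ N v (algebraMap (Pol N) (K N) p) = algebraMap (Pol N) (K N) (shiftEquiv N v p) :=
  IsFractionRing.ringEquivOfRingEquiv_algebraMap _ _

lemma Γ_comp (v w : Fin N → ℤ) (f : K N) : Γ N v (Γ N w f) = Γ N (v + w) f := by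
  obtain ⟨a, b, _, rfl⟩ := IsFractionRing.div_surjective (A := Pol N) f
  simp only [map_div₀, Γ_algebraMap, shift_comp]

/-- indicator shift -/
def GI (I : Finset (Fin N)) : K N ≃+* K N := ΓA N (fun i => if i ∈ I then 1 else 0)

lemma GI_comp (I J : Finset (Fin N)) (f : K N) :
    GI N I (GI N J f) = GI N (I ∩ J) (GI N (I ∪ J) f) := by
  simp only [GI, ΓA, Γ_comp]
  congr 2
  funext i
  by_cases h1 : i ∈ I <;> by_cases h2 : i ∈ J <;> simp [h1, h2]

lemma qK_ne_zero : qK N ≠ 0 := by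
  simp [qK, qq, sq_ne_zero]

lemma GI_x_mem (I : Finset (Fin N)) (i : Fin N) (h : i ∈ I) :
    GI N I (xA N i) = qK N * xA N i := by
  simp only [GI, ΓA, xA, y, Γ_algebraMap, qK, ← map_mul]
  congr 1
  simp [shiftEquiv, shiftHom, h, qq]

lemma GI_x_notMem (I : Finset (Fin N)) (i : Fin N) (h : i ∉ I) :
    GI N I (xA N i) = xA N i := by
  simp only [GI, ΓA, xA, y, Γ_algebraMap]
  congr 1
  simp [shiftEquiv, shiftHom, h]

lemma xA_ne_zero (i : Fin N) : xA N i ≠ 0 := by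
  simp [xA, y]

lemma xA_ne (c : Rq) (i j : Fin N) (h : i ≠ j) :
    xA N i ≠ algebraMap (Pol N) (K N) (MvPolynomial.C c) * xA N j := by
  intro h'
  simp only [xA, y, ← map_mul] at h'
  have h2 := IsFractionRing.injective (Pol N) (K N) h'
  have h3 := congrArg (MvPolynomial.coeff (Finsupp.single i 1)) h2
  have h4 : (Finsupp.single j 1 : Fin N →₀ ℕ) ≠ Finsupp.single i 1 := fun h4 =>
    h (Finsupp.single_left_injective one_ne_zero h4).symm
  rw [MvPolynomial.coeff_C_mul, MvPolynomial.coeff_X, MvPolynomial.coeff_X, if_neg h4] at h3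
  simp at h3

lemma qK_pow_ne_one (n : ℕ) (hn : n ≠ 0) : qK N ^ n ≠ 1 := by
  intro h
  simp only [qK, ← map_pow] at h
  rw [← map_one (algebraMap (Pol N) (K N))] at h
  have h2 := IsFractionRing.injective (Pol N) (K N) h
  rw [← MvPolynomial.C_1] at h2
  have h3 := MvPolynomial.C_injective _ _ h2
  simp only [qq, sQ, ← pow_mul] at h3
  rw [← RatFunc.algebraMap_X, ← map_pow, ← map_one (algebraMap (Polynomial ℚ) (RatFunc ℚ))] at h3
  have h4 := RatFunc.algebraMap_injective ℚ h3
  have h5 := congrArg Polynomial.natDegree h4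
  simp at h5
  exact hn h5

/-- the basic factor -/
def ff (i j : Fin N) : K N := xA N i / (xA N i - xA N j)

/-- One term of the product of two operators. -/
def tm (k k' : ℤ) (I J : Finset (Fin N)) (f : K N) : K N :=
  (∏ i ∈ I, xA N i) ^ k * ((∏ i ∈ I, ∏ j ∈ Iᶜ, ff N i j) *
    GI N I ((∏ i ∈ J, xA N i) ^ k' * ((∏ i ∈ J, ∏ j ∈ Jᶜ, ff N i j) * GI N J f)))

lemma MA_MA (a b : ℕ) (k k' : ℤ) (f : K N) :
    MA N a k (MA N b k' f) = ∑ I ∈ Finset.powersetCard a Finset.univ,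
      ∑ J ∈ Finset.powersetCard b Finset.univ, tm N k k' I J f := by
  unfold MA tm
  apply Finset.sum_congr rfl
  intro I _
  rw [map_sum, Finset.mul_sum, Finset.mul_sum]
  rfl

/-- The common factor. -/
def Com (L S : Finset (Fin N)) (m : ℤ) (f : K N) : K N :=
  (∏ i ∈ L, xA N i) ^ m * (∏ i ∈ L, ∏ j ∈ S, ff N i j) * (∏ i ∈ S, ∏ j ∈ (L ∪ S)ᶜ, ff N i j) *
  (∏ i ∈ L, ∏ j ∈ (L ∪ S)ᶜ, ff N i j) *
  (∏ i ∈ L, ∏ j ∈ (L ∪ S)ᶜ, qK N * xA N i / (qK N * xA N i - xA N j)) *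
  GI N L (GI N (L ∪ S) f)

set_option maxHeartbeats 1000000 in
lemma tm_eq (k k' : ℤ) (L I J : Finset (Fin N)) (hLI : Disjoint L I) (hLJ : Disjoint L J)
    (hIJ : Disjoint I J) (f : K N) :
    tm N k k' (L ∪ I) (L ∪ J) f =
      Com N L (I ∪ J) (k + k') f * qK N ^ (k' * (L.card : ℤ)) *
      ((∏ i ∈ I, xA N i) ^ k * (∏ j ∈ J, xA N j) ^ k' *
        ∏ i ∈ I, ∏ j ∈ J, xA N i * xA N j * gk (qK N) (xA N) i j) := by
  have hI := Finset.disjoint_left.1 hLI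
  have hJ := Finset.disjoint_left.1 hLJ
  have hI' := Finset.disjoint_left.1 hIJ
  have hc1 : (L ∪ I)ᶜ = J ∪ (L ∪ (I ∪ J))ᶜ := by
    ext t; simp only [Finset.mem_compl, Finset.mem_union]
    have := @hI t; have := @hJ t; have := @hI' t
    tauto
  have hc2 : (L ∪ J)ᶜ = I ∪ (L ∪ (I ∪ J))ᶜ := by
    ext t; simp only [Finset.mem_compl, Finset.mem_union]
    have := @hI t; have := @hJ t; have := @hI' t
    tauto
  have hd1 : Disjoint J (L ∪ (I ∪ J))ᶜ := by
    rw [Finset.disjoint_left]; intro t; simp; tauto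
  have hd2 : Disjoint I (L ∪ (I ∪ J))ᶜ := by
    rw [Finset.disjoint_left]; intro t; simp; tauto
  have hG : GI N (L ∪ I) (GI N (L ∪ J) f) = GI N L (GI N (L ∪ (I ∪ J)) f) := by
    rw [GI_comp]
    have h1 : (L ∪ I) ∩ (L ∪ J) = L := by
      ext t; simp only [Finset.mem_inter, Finset.mem_union]
      have := @hI' t
      tauto
    have h2 : (L ∪ I) ∪ (L ∪ J) = L ∪ (I ∪ J) := by
      ext t; simp only [Finset.mem_union]; tauto
    rw [h1, h2]
  unfold tm Com
  rw [map_mul, map_mul, hG, hc1, hc2]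
  set R := (L ∪ (I ∪ J))ᶜ with hR
  have gL : ∀ i ∈ L, GI N (L ∪ I) (xA N i) = qK N * xA N i := fun i hi =>
    GI_x_mem N _ _ (Finset.mem_union_left _ hi)
  have gI : ∀ i ∈ I, GI N (L ∪ I) (xA N i) = qK N * xA N i := fun i hi =>
    GI_x_mem N _ _ (Finset.mem_union_right _ hi)
  have gJ : ∀ i ∈ J, GI N (L ∪ I) (xA N i) = xA N i := fun i hi =>
    GI_x_notMem N _ _ (by
      rw [Finset.mem_union]
      rintro (h | h)
      · exact hJ h hi
      · exact hI' h hi)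
  have gR : ∀ i ∈ R, GI N (L ∪ I) (xA N i) = xA N i := fun i hi =>
    GI_x_notMem N _ _ (by
      simp only [hR, Finset.mem_compl, Finset.mem_union] at hi ⊢
      tauto)
  have e1 : GI N (L ∪ I) ((∏ i ∈ L ∪ J, xA N i) ^ k') =
      qK N ^ (k' * (L.card : ℤ)) * (∏ i ∈ L, xA N i) ^ k' * (∏ i ∈ J, xA N i) ^ k' := by
    rw [map_zpow₀, map_prod, Finset.prod_union hLJ, Finset.prod_congr rfl gL,
      Finset.prod_congr rfl gJ, Finset.prod_mul_distrib, Finset.prod_const, mul_zpow, mul_zpow,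
      ← zpow_natCast, ← zpow_mul, mul_comm (L.card : ℤ) k']
  have hq := qK_ne_zero N
  have e2 : GI N (L ∪ I) (∏ i ∈ L ∪ J, ∏ j ∈ I ∪ R, ff N i j) =
      (∏ i ∈ L, ∏ j ∈ I, ff N i j) *
      (∏ i ∈ L, ∏ j ∈ R, qK N * xA N i / (qK N * xA N i - xA N j)) *
      ((∏ i ∈ J, ∏ j ∈ I, xA N i / (xA N i - qK N * xA N j)) * (∏ i ∈ J, ∏ j ∈ R, ff N i j)) := by
    have f1 : ∏ i ∈ L, ∏ j ∈ I, GI N (L ∪ I) (ff N i j) = ∏ i ∈ L, ∏ j ∈ I, ff N i j := by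
      refine Finset.prod_congr rfl fun i hi => Finset.prod_congr rfl fun j hj => ?_
      rw [ff, map_div₀, map_sub, gL i hi, gI j hj, ← mul_sub, mul_div_mul_left _ _ hq]
    have f2 : ∏ i ∈ L, ∏ j ∈ R, GI N (L ∪ I) (ff N i j) =
        ∏ i ∈ L, ∏ j ∈ R, qK N * xA N i / (qK N * xA N i - xA N j) := by
      refine Finset.prod_congr rfl fun i hi => Finset.prod_congr rfl fun j hj => ?_
      rw [ff, map_div₀, map_sub, gL i hi, gR j hj]
    have f3 : ∏ i ∈ J, ∏ j ∈ I, GI N (L ∪ I) (ff N i j) =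
        ∏ i ∈ J, ∏ j ∈ I, xA N i / (xA N i - qK N * xA N j) := by
      refine Finset.prod_congr rfl fun i hi => Finset.prod_congr rfl fun j hj => ?_
      rw [ff, map_div₀, map_sub, gJ i hi, gI j hj]
    have f4 : ∏ i ∈ J, ∏ j ∈ R, GI N (L ∪ I) (ff N i j) = ∏ i ∈ J, ∏ j ∈ R, ff N i j := by
      refine Finset.prod_congr rfl fun i hi => Finset.prod_congr rfl fun j hj => ?_
      rw [ff, map_div₀, map_sub, gJ i hi, gR j hj]
    rw [← f1, ← f2, ← f3, ← f4, map_prod, Finset.prod_union hLJ]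
    simp_rw [map_prod, Finset.prod_union hd2, Finset.prod_mul_distrib]
  have e3 : (∏ i ∈ L ∪ I, ∏ j ∈ J ∪ R, ff N i j) =
      (∏ i ∈ L, ∏ j ∈ J, ff N i j) * (∏ i ∈ L, ∏ j ∈ R, ff N i j) *
      ((∏ i ∈ I, ∏ j ∈ J, ff N i j) * (∏ i ∈ I, ∏ j ∈ R, ff N i j)) := by
    rw [Finset.prod_union hLI]
    simp_rw [Finset.prod_union hd1, Finset.prod_mul_distrib]
  have e4 : (∏ i ∈ I, ∏ j ∈ J, xA N i * xA N j * gk (qK N) (xA N) i j) =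
      (∏ i ∈ I, ∏ j ∈ J, ff N i j) * (∏ i ∈ J, ∏ j ∈ I, xA N i / (xA N i - qK N * xA N j)) := by
    rw [Finset.prod_comm (s := J)]
    simp_rw [← Finset.prod_mul_distrib]
    refine Finset.prod_congr rfl fun i hi => Finset.prod_congr rfl fun j hj => ?_
    rw [ff, gk, div_mul_div_comm, div_eq_mul_inv]
  have e5 : (∏ i ∈ L, ∏ j ∈ I ∪ J, ff N i j) =
      (∏ i ∈ L, ∏ j ∈ I, ff N i j) * (∏ i ∈ L, ∏ j ∈ J, ff N i j) := by
    simp_rw [Finset.prod_union hIJ, Finset.prod_mul_distrib]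
  have e6 : (∏ i ∈ I ∪ J, ∏ j ∈ R, ff N i j) =
      (∏ i ∈ I, ∏ j ∈ R, ff N i j) * (∏ i ∈ J, ∏ j ∈ R, ff N i j) := Finset.prod_union hIJ
  have hL0 : (∏ i ∈ L, xA N i) ≠ 0 := Finset.prod_ne_zero_iff.2 fun i _ => xA_ne_zero N i
  rw [e1, e2, e3, e4, e5, e6, Finset.prod_union hLI, mul_zpow, zpow_add₀ hL0]
  ring

/-- Regrouping pairs `(I, J)` by intersection and symmetric difference. -/
lemma sum_regroup {M : Type*} [AddCommMonoid M] (a b : ℕ)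
    (F : Finset (Fin N) → Finset (Fin N) → M) :
    ∑ I ∈ Finset.powersetCard a Finset.univ, ∑ J ∈ Finset.powersetCard b Finset.univ, F I J =
    ∑ p ∈ (Finset.univ : Finset (Finset (Fin N) × Finset (Fin N))).filter
        (fun p => Disjoint p.1 p.2 ∧ p.1.card ≤ a ∧ p.1.card ≤ b ∧
          p.2.card + 2 * p.1.card = a + b),
      ∑ I ∈ Finset.powersetCard (a - p.1.card) p.2, F (p.1 ∪ I) (p.1 ∪ (p.2 \ I)) := by
  rw [← Finset.sum_product', Finset.sum_sigma']
  refine Finset.sum_bij'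
    (fun p _ => ⟨(p.1 ∩ p.2, (p.1 ∪ p.2) \ (p.1 ∩ p.2)), p.1 \ p.2⟩)
    (fun s _ => (s.1.1 ∪ s.2, s.1.1 ∪ (s.1.2 \ s.2))) ?_ ?_ ?_ ?_ ?_
  · rintro ⟨I, J⟩ h
    simp only [Finset.mem_product, Finset.mem_powersetCard_univ] at h
    simp only [Finset.mem_sigma, Finset.mem_filter, Finset.mem_univ, true_and,
      Finset.mem_powersetCard]
    have h1 := Finset.card_union_add_card_inter I J
    have h2 : ((I ∪ J) \ (I ∩ J)).card = (I ∪ J).card - (I ∩ J).card :=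
      Finset.card_sdiff_of_subset (fun t => by simp; tauto)
    have h3 : (I ∩ J).card ≤ (I ∪ J).card := Finset.card_le_card (fun t => by simp; tauto)
    have h4 : (I ∩ J).card ≤ I.card := Finset.card_le_card Finset.inter_subset_left
    have h5 : (I ∩ J).card ≤ J.card := Finset.card_le_card Finset.inter_subset_right
    have h6 := Finset.card_sdiff_add_card_inter I J
    refine ⟨⟨Finset.disjoint_sdiff, by omega, by omega, by omega⟩, ?_, by omega⟩
    intro t; simp; tauto
  · rintro ⟨⟨L, S⟩, I⟩ h
    simp only [Finset.mem_sigma, Finset.mem_filter, Finset.mem_univ, true_and,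
      Finset.mem_powersetCard] at h
    obtain ⟨⟨h1, h2, h3, h4⟩, h5, h6⟩ := h
    simp only [Finset.mem_product, Finset.mem_powersetCard_univ]
    have h7 : (S \ I).card = S.card - I.card := Finset.card_sdiff_of_subset h5
    have h8 := Finset.card_le_card h5
    rw [Finset.card_union_of_disjoint (h1.mono_right h5),
      Finset.card_union_of_disjoint (h1.mono_right Finset.sdiff_subset)]
    omega
  · rintro ⟨I, J⟩ h
    simp only [Prod.mk.injEq]
    constructor <;> ext t <;> simp <;> tauto
  · rintro ⟨⟨L, S⟩, I⟩ h
    simp only [Finset.mem_sigma, Finset.mem_filter, Finset.mem_univ, true_and,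
      Finset.mem_powersetCard] at h
    obtain ⟨⟨h1, -⟩, h5, -⟩ := h
    have hLS := Finset.disjoint_left.1 h1
    simp only [Sigma.mk.injEq, Prod.mk.injEq, heq_eq_eq]
    refine ⟨⟨?_, ?_⟩, ?_⟩ <;> ext t <;> have := @hLS t <;> have := @h5 t <;>
      simp only [Finset.mem_inter, Finset.mem_union, Finset.mem_sdiff] <;> tauto
  · rintro ⟨I, J⟩ h
    congr 1 <;> ext t <;> simp <;> tauto

lemma sum_eq_Phi (S : Finset (Fin N)) (α β e s : ℕ) (k k' c : ℤ) (g : Fin N → Fin N → K N)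
    (hS : S.card = α + β) (h1 : c + e = k + β) (h2 : c + s = k' + α) :
    ∑ I ∈ Finset.powersetCard α S,
      ((∏ i ∈ I, xA N i) ^ k * (∏ j ∈ S \ I, xA N j) ^ k' *
        ∏ i ∈ I, ∏ j ∈ S \ I, xA N i * xA N j * g i j) =
    (∏ i ∈ S, xA N i) ^ c * Phi g S α (fun i => xA N i ^ e) (fun i => xA N i ^ s) := by
  unfold Phi
  rw [Finset.mul_sum]
  apply Finset.sum_congr rfl
  intro I hI
  rw [Finset.mem_powersetCard] at hI
  have hJ : (S \ I).card = β := by rw [Finset.card_sdiff_of_subset hI.1]; omega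
  have hI0 : (∏ i ∈ I, xA N i) ≠ 0 := Finset.prod_ne_zero_iff.2 fun i _ => xA_ne_zero N i
  have hJ0 : (∏ i ∈ S \ I, xA N i) ≠ 0 := Finset.prod_ne_zero_iff.2 fun i _ => xA_ne_zero N i
  rw [← Finset.prod_sdiff hI.1]
  simp only [Finset.prod_mul_distrib, Finset.prod_const, hJ, hI.2, Finset.prod_pow, mul_zpow]
  have e1 : (∏ i ∈ I, xA N i) ^ c * (∏ i ∈ I, xA N i) ^ e =
      (∏ i ∈ I, xA N i) ^ k * (∏ i ∈ I, xA N i) ^ β := by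
    rw [← zpow_natCast, ← zpow_natCast, ← zpow_add₀ hI0, ← zpow_add₀ hI0, h1]
  have e2 : (∏ i ∈ S \ I, xA N i) ^ c * (∏ i ∈ S \ I, xA N i) ^ s =
      (∏ i ∈ S \ I, xA N i) ^ k' * (∏ i ∈ S \ I, xA N i) ^ α := by
    rw [← zpow_natCast, ← zpow_natCast, ← zpow_add₀ hJ0, ← zpow_add₀ hJ0, h2]
  set G := ∏ i ∈ I, ∏ j ∈ S \ I, g i j
  calc _ = ((∏ i ∈ I, xA N i) ^ k * (∏ i ∈ I, xA N i) ^ β) *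
        ((∏ i ∈ S \ I, xA N i) ^ k' * (∏ i ∈ S \ I, xA N i) ^ α) * G := by ring
    _ = _ := by rw [← e1, ← e2]; ring

lemma main_le (a b : ℕ) (hab : b ≤ a) (k k' : ℤ) (h : |k - k'| ≤ (a : ℤ) - b + 1) (f : K N) :
    MA N a k (MA N b k' f) = qK N ^ ((k' - k) * (b : ℤ)) * MA N b k' (MA N a k f) := by
  have hq := qK_ne_zero N
  rw [MA_MA, MA_MA, Finset.sum_comm (s := Finset.powersetCard b Finset.univ),
    sum_regroup, sum_regroup N a b (fun I J => tm N k' k J I f), Finset.mul_sum]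
  apply Finset.sum_congr rfl
  rintro ⟨L, S⟩ hp
  simp only [Finset.mem_filter, Finset.mem_univ, true_and] at hp
  obtain ⟨hLS, hLa, hLb, hcard⟩ := hp
  obtain ⟨d, rfl⟩ := Nat.exists_eq_add_of_le hab
  obtain ⟨β, rfl⟩ := Nat.exists_eq_add_of_le hLb
  have hα : L.card + β + d - L.card = β + d := by omega
  simp only [hα]
  -- rewrite terms
  have t1 : ∀ I ∈ Finset.powersetCard (β + d) S, tm N k k' (L ∪ I) (L ∪ (S \ I)) f =
      Com N L S (k + k') f * qK N ^ (k' * (L.card : ℤ)) *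
      ((∏ i ∈ I, xA N i) ^ k * (∏ j ∈ S \ I, xA N j) ^ k' *
        ∏ i ∈ I, ∏ j ∈ S \ I, xA N i * xA N j * gk (qK N) (xA N) i j) := by
    intro I hI
    rw [Finset.mem_powersetCard] at hI
    rw [tm_eq N k k' L I (S \ I) (hLS.mono_right hI.1) (hLS.mono_right Finset.sdiff_subset)
      Finset.disjoint_sdiff, Finset.union_sdiff_of_subset hI.1]
  have t2 : ∀ I ∈ Finset.powersetCard (β + d) S, tm N k' k (L ∪ (S \ I)) (L ∪ I) f =
      Com N L S (k + k') f * qK N ^ (k * (L.card : ℤ)) *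
      ((∏ i ∈ I, xA N i) ^ k * (∏ j ∈ S \ I, xA N j) ^ k' *
        ∏ i ∈ I, ∏ j ∈ S \ I, xA N i * xA N j * gk (qK N) (xA N) j i) := by
    intro I hI
    rw [Finset.mem_powersetCard] at hI
    rw [tm_eq N k' k L (S \ I) I (hLS.mono_right Finset.sdiff_subset) (hLS.mono_right hI.1)
      Finset.sdiff_disjoint, Finset.sdiff_union_of_subset hI.1, Finset.prod_comm (s := S \ I),
      add_comm k' k]
    have : ∀ i j, xA N i * xA N j * gk (qK N) (xA N) i j =
      xA N j * xA N i * gk (qK N) (xA N) i j := fun i j => by ring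
    simp_rw [this]
    ring
  rw [Finset.sum_congr rfl t1, Finset.sum_congr rfl t2, ← Finset.mul_sum, ← Finset.mul_sum]
  -- exponents
  obtain ⟨e, s, he, hs, hes⟩ : ∃ e s : ℕ, e ≤ 1 ∧ s ≤ 2 * d + 1 ∧ (e : ℤ) - s = k - k' - d := by
    push_cast at h
    rw [abs_le] at h
    exact ⟨(k - k' - d).toNat, (-(k - k' - d)).toNat, by omega, by omega, by omega⟩
  have hS : S.card = (β + d) + β := by omega
  rw [sum_eq_Phi N S (β + d) β e s k k' (k + β - e) _ hS (by ring) (by push_cast; linarith),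
    sum_eq_Phi N S (β + d) β e s k k' (k + β - e) (fun i j => gk (qK N) (xA N) j i) hS (by ring)
      (by push_cast; linarith)]
  have x1 : ∀ i j, i ≠ j → xA N i ≠ xA N j := fun i j hij => by
    have := xA_ne N 1 i j hij
    simpa using this
  have x2 : ∀ i j, i ≠ j → xA N i ≠ qK N * xA N j := fun i j hij => xA_ne N qq i j hij
  have x3 : ∀ i j, i ≠ j → xA N i ≠ qK N ^ 2 * xA N j := fun i j hij => by
    have := xA_ne N (qq ^ 2) i j hij
    simpa [qK] using this
  have key := key_identity (qK N) (xA N) hq (by simpa using qK_pow_ne_one N 1 one_ne_zero)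
    (qK_pow_ne_one N 2 two_ne_zero) (xA_ne_zero N) x1 x2 x3 d e s he hs β S (by omega)
  set F0 := Phi (gk (qK N) (xA N)) S (β + d) (fun i => xA N i ^ e) (fun i => xA N i ^ s)
  set G0 := Phi (fun i j => gk (qK N) (xA N) j i) S (β + d) (fun i => xA N i ^ e)
    (fun i => xA N i ^ s)
  have key2 : F0 = qK N ^ ((k' - k) * (β : ℤ)) * G0 := by
    apply mul_left_cancel₀ (pow_ne_zero ((e + d) * β) hq)
    rw [key, ← mul_assoc, ← zpow_natCast, ← zpow_natCast, ← zpow_add₀ hq]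
    congr 2
    push_cast
    have : k' - k = s - e - d := by linarith
    rw [this]
    ring
  have hz : qK N ^ (k' * (L.card : ℤ)) * qK N ^ ((k' - k) * (β : ℤ)) =
      qK N ^ ((k' - k) * ((L.card + β : ℕ) : ℤ)) * qK N ^ (k * (L.card : ℤ)) := by
    rw [← zpow_add₀ hq, ← zpow_add₀ hq]
    congr 1
    push_cast
    ring
  rw [key2]
  linear_combination (Com N L S (k + k') f * (∏ i ∈ S, xA N i) ^ (k + β - e : ℤ) * G0) * hz

end OpSection

/-- for `a,b ∈ {1,…,N}` and `k,k' ∈ ℤ` with `|k−k'| ≤ |a−b|+1`, the type `A`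
difference operators satisfy `M_{a,k} ∘ M_{b,k'} = q^{(k'−k)·min(a,b)} M_{b,k'} ∘ M_{a,k}`. -/
theorem stmt1 (N a b : ℕ) (ha : 1 ≤ a) (ha' : a ≤ N) (hb : 1 ≤ b) (hb' : b ≤ N)
    (k k' : ℤ) (h : |k - k'| ≤ |(a : ℤ) - (b : ℤ)| + 1) :
    MA N a k ∘ MA N b k' =
      (qK N ^ ((k' - k) * min (a : ℤ) (b : ℤ))) • (MA N b k' ∘ MA N a k) := by
  funext f
  simp only [Function.comp_apply, Pi.smul_apply, smul_eq_mul]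
  rcases le_total b a with hab | hab
  · have hab' : (b : ℤ) ≤ a := by exact_mod_cast hab
    rw [abs_of_nonneg (sub_nonneg.2 hab')] at h
    rw [min_eq_right hab']
    exact main_le N a b hab k k' h f
  · have hab' : (a : ℤ) ≤ b := by exact_mod_cast hab
    rw [abs_of_nonpos (sub_nonpos.2 hab'), abs_sub_comm] at h
    rw [min_eq_left hab', main_le N b a hab k' k (by linarith) f, ← mul_assoc,
      ← zpow_add₀ (qK_ne_zero N)]
    have : (k' - k) * (a : ℤ) + (k - k') * (a : ℤ) = 0 := by ring
    rw [this, zpow_zero, one_mul]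
end
end
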